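/- Let φ map each nonempty word x₁⋯x_k over X to the product x̄₁⋯x̄_k in P_n, where ē_r is substituted for e_r and t̄_{ij} for t_{ij}. Then: (a) every element of P_n of rank < n equals φ(w) for some nonempty word w over X; and (b) for all nonempty words u, v over X, φ(u) = φ(v) if and only if u ~ v. That is, the singular part P_n∖S_n of the partition monoid has semigroup presentation with generators {e_r} ∪ {t_{ij}} and defining relations (R1)–(R10), via φ. -/

import Mathlib

namespace PaperFormal

/-- The alphabet `X`: letters `e_r` for `r ∈ {1,…,n}` (modelled as `Fin n`) and
letters `t_{ij} = t_{ji}` for distinct `i,j`, modelled as unordered pairs. -/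
abbrev XA (n : ℕ) := Fin n ⊕ Sym2 (Fin n)

/-- The word consisting of the single letter `e_r`. -/
def E {n : ℕ} (r : Fin n) : FreeMonoid (XA n) := FreeMonoid.of (Sum.inl r)

/-- The word consisting of the single letter `t_{ij} = t_{ji}`. -/
def T {n : ℕ} (i j : Fin n) : FreeMonoid (XA n) := FreeMonoid.of (Sum.inr s(i, j))

/-- The defining relations (R1)–(R10). -/
inductive XRel {n : ℕ} : FreeMonoid (XA n) → FreeMonoid (XA n) → Prop
  | r1 (i : Fin n) : XRel (E i * E i) (E i)
  | r2 (i j : Fin n) (h : i ≠ j) : XRel (E i * E j) (E j * E i)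
  | r3 (i j : Fin n) (h : i ≠ j) : XRel (T i j * T i j) (T i j)
  | r4 (i j k l : Fin n) (hij : i ≠ j) (hkl : k ≠ l) : XRel (T i j * T k l) (T k l * T i j)
  | r5 (i j k : Fin n) (hij : i ≠ j) (hjk : j ≠ k) (hik : i ≠ k) :
      XRel (T i j * T j k) (T j k * T k i)
  | r6 (i j k : Fin n) (hij : i ≠ j) (hki : k ≠ i) (hkj : k ≠ j) :
      XRel (T i j * E k) (E k * T i j)
  | r7 (i j k : Fin n) (hij : i ≠ j) (h : k = i ∨ k = j) : XRel (T i j * E k * T i j) (T i j)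
  | r8 (i j k : Fin n) (hij : i ≠ j) (h : k = i ∨ k = j) : XRel (E k * T i j * E k) (E k)
  | r9 (i j k : Fin n) (hij : i ≠ j) (hjk : j ≠ k) (hik : i ≠ k) :
      XRel (E k * T k i * E i * T i j * E j * T j k * E k)
           (E k * T k j * E j * T j i * E i * T i k * E k)
  | r10 (i j k l : Fin n) (hij : i ≠ j) (hik : i ≠ k) (hil : i ≠ l) (hjk : j ≠ k)
      (hjl : j ≠ l) (hkl : k ≠ l) :
      XRel (E k * T k i * E i * T i j * E j * T j l * E l * T l k * E k)
           (E k * T k l * E l * T l i * E i * T i j * E j * T j k * E k)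

/-- The congruence `~` on the free monoid `X*` generated by relations (R1)–(R10). -/
def xcon (n : ℕ) : Con (FreeMonoid (XA n)) := conGen XRel

/-- The word `z_{ij} = e_i t_{ij} e_j`. -/
def Z {n : ℕ} (i j : Fin n) : FreeMonoid (XA n) := E i * T i j * E j

/-- The kernel of a function, as a setoid. -/
def kernelSetoid {α β : Type*} (f : α → β) : Setoid α :=
  ⟨fun x y => f x = f y, ⟨fun _ => rfl, Eq.symm, Eq.trans⟩⟩

/-- An element of the partition monoid `P_n`: an equivalence relation (set partition) of the
`2n`-element set `{1,…,n} ∪ {1',…,n'}`, modelled as `Fin n ⊕ Fin n` (`Sum.inl` is the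
unprimed row, `Sum.inr` the primed row). -/
abbrev PartEq (n : ℕ) := Setoid (Fin n ⊕ Fin n)

/-- Embedding of a two-row set into the three-row set: rows 1 and 2. -/
def emb12 {n : ℕ} : Fin n ⊕ Fin n → Fin n ⊕ (Fin n ⊕ Fin n)
  | Sum.inl a => Sum.inl a
  | Sum.inr a => Sum.inr (Sum.inl a)

/-- Embedding of a two-row set into the three-row set: rows 2 and 3. -/
def emb23 {n : ℕ} : Fin n ⊕ Fin n → Fin n ⊕ (Fin n ⊕ Fin n)
  | Sum.inl a => Sum.inr (Sum.inl a)
  | Sum.inr a => Sum.inr (Sum.inr a)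

/-- Embedding of a two-row set into the three-row set: rows 1 and 3. -/
def emb13 {n : ℕ} : Fin n ⊕ Fin n → Fin n ⊕ (Fin n ⊕ Fin n)
  | Sum.inl a => Sum.inl a
  | Sum.inr a => Sum.inr (Sum.inr a)

/-- The product `αβ` in the partition monoid: take the smallest equivalence on the three-row
set containing the copy of `α` on rows 1–2 and the copy of `β` on rows 2–3, and restrict it
to rows 1 and 3. -/
def pcompose {n : ℕ} (α β : PartEq n) : PartEq n :=
  ⟨fun x y => Relation.EqvGen (fun u v =>
      (∃ a b, α.r a b ∧ u = emb12 a ∧ v = emb12 b) ∨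
      (∃ a b, β.r a b ∧ u = emb23 a ∧ v = emb23 b)) (emb13 x) (emb13 y),
   ⟨fun _ => Relation.EqvGen.refl _,
    fun h => Relation.EqvGen.symm _ _ h,
    fun h h' => Relation.EqvGen.trans _ _ _ h h'⟩⟩

/-- The identity of `P_n`: the partition with blocks `{x, x'}`. -/
def idPart (n : ℕ) : PartEq n :=
  kernelSetoid (fun x : Fin n ⊕ Fin n => match x with
    | Sum.inl a => a
    | Sum.inr a => a)

/-- The rank of `α ∈ P_n`: the number of blocks of `α` meeting both rows. -/
noncomputable def prank {n : ℕ} (α : PartEq n) : ℕ :=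
  Nat.card {q : Quotient α // (∃ a : Fin n, Quotient.mk α (Sum.inl a) = q) ∧
    (∃ b : Fin n, Quotient.mk α (Sum.inr b) = q)}

/-- The partition `ē_r`, with blocks `{r}`, `{r'}` and `{x, x'}` for `x ≠ r`. -/
def ebarP {n : ℕ} (r : Fin n) : PartEq n :=
  kernelSetoid (fun x : Fin n ⊕ Fin n => match x with
    | Sum.inl a => if a = r then (Sum.inr true : Fin n ⊕ Bool) else Sum.inl a
    | Sum.inr a => if a = r then Sum.inr false else Sum.inl a)

/-- The partition `t̄_{ij}` (for `i ≠ j`), with blocks `{i, j, i', j'}` and `{x, x'}`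
for `x ∉ {i, j}`. -/
def tbarP {n : ℕ} (i j : Fin n) : PartEq n :=
  kernelSetoid (fun x : Fin n ⊕ Fin n => match x with
    | Sum.inl a => if a = i ∨ a = j then i else a
    | Sum.inr a => if a = i ∨ a = j then i else a)

/-- The smaller element of an unordered pair. -/
def pmin {n : ℕ} (p : Sym2 (Fin n)) : Fin n :=
  Sym2.lift ⟨fun a b => min a b, fun a b => min_comm a b⟩ p

/-- The larger element of an unordered pair. -/
def pmax {n : ℕ} (p : Sym2 (Fin n)) : Fin n :=
  Sym2.lift ⟨fun a b => max a b, fun a b => max_comm a b⟩ p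

/-- The image `x̄` of a letter of `X` in `P_n`: `e_r ↦ ē_r`, `t_{ij} ↦ t̄_{ij}`. -/
def genX {n : ℕ} : XA n → PartEq n
  | Sum.inl r => ebarP r
  | Sum.inr p => tbarP (pmin p) (pmax p)

/-- The map `φ` sending a word `x₁⋯x_k` over `X` to the product `x̄₁⋯x̄_k` in `P_n`. -/
def PhiX {n : ℕ} (w : FreeMonoid (XA n)) : PartEq n :=
  match FreeMonoid.toList w with
  | [] => idPart n
  | x :: rest => (rest.map genX).foldl pcompose (genX x)

/-- The relations (R1)–(R10) for families `e`, `t` of elements of a monoid, with the convention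
`t i i = 1`. -/
structure SingularRelations {ι M : Type*} [Monoid M] (e : ι → M) (t : ι → ι → M) : Prop where
  e_idem (i : ι) : e i * e i = e i
  e_comm (i j : ι) : e i * e j = e j * e i
  t_self (i : ι) : t i i = 1
  t_symm (i j : ι) : t i j = t j i
  t_idem (i j : ι) : t i j * t i j = t i j
  t_comm (i j k l : ι) : t i j * t k l = t k l * t i j
  t_triangle (i j k : ι) : t i j * t j k = t j k * t k i
  t_e_comm (i j k : ι) : k ≠ i → k ≠ j → t i j * e k = e k * t i j
  t_e_t (i j : ι) : i ≠ j → t i j * e i * t i j = t i j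
  e_t_e (i j : ι) : e i * t i j * e i = e i
  hole_triangle (i j k : ι) : i ≠ j → j ≠ k → i ≠ k →
    (e k * t k i * e i) * (e i * t i j * e j) * (e j * t j k * e k) =
      (e k * t k j * e j) * (e j * t j i * e i) * (e i * t i k * e k)
  hole_square (i j k l : ι) : i ≠ j → i ≠ k → i ≠ l → j ≠ k → j ≠ l → k ≠ l →
    (e k * t k i * e i) * (e i * t i j * e j) * (e j * t j l * e l) * (e l * t l k * e k) =
      (e k * t k l * e l) * (e l * t l i * e i) * (e i * t i j * e j) * (e j * t j k * e k)

/-- The element `z_{ij} = e_i t_{ij} e_j`, which moves a hole from `i` to `j`. -/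
def holeStep {ι M : Type*} [Monoid M] (e : ι → M) (t : ι → ι → M) (i j : ι) : M :=
  e i * t i j * e j

/-- `HolePath e t S k h σ m`: the element `m` is a product of hole steps along a path in `S`
from `k` to `h`, and this path permutes the positions by `σ`. -/
inductive HolePath {ι M : Type*} [Monoid M] [DecidableEq ι] (e : ι → M) (t : ι → ι → M)
    (S : Finset ι) (k : ι) : ι → Equiv.Perm ι → M → Prop
  | nil : HolePath e t S k k 1 (e k)
  | snoc {h : ι} {σ : Equiv.Perm ι} {m : M} (x : ι) (hx : x ∈ S)
      (hp : HolePath e t S k h σ m) :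
      HolePath e t S k x (Equiv.swap h x * σ) (m * holeStep e t h x)

/-- The product of the `e i` with `i ∈ A`. -/
noncomputable def eProd {ι M : Type*} [Monoid M] (e : ι → M) (A : Finset ι) : M :=
  (A.toList.map e).prod

/-- The product of the `t i j` with `(i, j)` in the list `l`. -/
def tProd {ι M : Type*} [Monoid M] (t : ι → ι → M) (l : List (ι × ι)) : M :=
  (l.map fun q => t q.1 q.2).prod

/-- The equivalence relation generated by a list of pairs. -/
def pairSetoid {ι : Type*} (l : List (ι × ι)) : Setoid ι :=
  Relation.EqvGen.setoid fun a b => (a, b) ∈ l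

namespace SingularRelations

variable {ι M : Type*} [Monoid M] {e : ι → M} {t : ι → ι → M}

theorem e_idem_assoc (H : SingularRelations e t) (i : ι) (x : M) : e i * (e i * x) = e i * x := by
  rw [← mul_assoc, H.e_idem]

theorem t_e_comm_assoc (H : SingularRelations e t) {i j k : ι} (hi : k ≠ i) (hj : k ≠ j) (x : M) :
    t i j * (e k * x) = e k * (t i j * x) := by
  rw [← mul_assoc, H.t_e_comm i j k hi hj, mul_assoc]

theorem t_e_t_assoc (H : SingularRelations e t) {i j : ι} (hij : i ≠ j) (x : M) :
    t i j * (e i * (t i j * x)) = t i j * x := by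
  rw [← mul_assoc, ← mul_assoc, H.t_e_t i j hij]

theorem t_e_t_right (H : SingularRelations e t) {i j : ι} (hij : i ≠ j) :
    t i j * e j * t i j = t i j := by
  rw [H.t_symm i j, H.t_e_t j i hij.symm]

theorem e_t_e_right (H : SingularRelations e t) (i j : ι) : e j * t i j * e j = e j := by
  rw [H.t_symm i j, H.e_t_e]

theorem t_triangle_right (H : SingularRelations e t) (i j k : ι) :
    t i j * t i k = t j k * t i j := by
  rw [H.t_symm i j, H.t_triangle j i k, H.t_triangle i k j, H.t_symm k j]

theorem step_self (H : SingularRelations e t) (i : ι) : holeStep e t i i = e i := by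
  rw [holeStep, H.t_self, mul_one, H.e_idem]

theorem e_mul_step (H : SingularRelations e t) (i j : ι) :
    e i * holeStep e t i j = holeStep e t i j := by
  simp only [holeStep, mul_assoc, H.e_idem_assoc]

theorem step_mul_e (H : SingularRelations e t) (i j : ι) :
    holeStep e t i j * e j = holeStep e t i j := by
  simp only [holeStep, mul_assoc, H.e_idem]

theorem step_back (H : SingularRelations e t) (i j : ι) :
    holeStep e t i j * holeStep e t j i = e i := by
  rcases eq_or_ne i j with rfl | hij
  · rw [H.step_self, H.e_idem]
  · simp only [holeStep, mul_assoc, H.e_idem_assoc, H.t_symm j i]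
    rw [← mul_assoc (e j), ← mul_assoc (t i j), ← mul_assoc (t i j), H.t_e_t_right hij,
      ← mul_assoc, H.e_t_e]

variable [DecidableEq ι]

theorem step_mul_e_swap (H : SingularRelations e t) (h x b : ι) :
    holeStep e t h x * e (Equiv.swap h x b) = e b * holeStep e t h x := by
  rcases eq_or_ne b h with rfl | hbh
  · rw [Equiv.swap_apply_left, H.step_mul_e, H.e_mul_step]
  rcases eq_or_ne b x with rfl | hbx
  · rw [Equiv.swap_apply_right]
    calc holeStep e t h b * e h = e h * t h b * e h * e b := by
          rw [holeStep, mul_assoc, H.e_comm b h, mul_assoc, mul_assoc, mul_assoc]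
      _ = e h * (e b * t h b * e b) := by rw [H.e_t_e, H.e_t_e_right]
      _ = e b * holeStep e t h b := by
          simp only [holeStep, ← mul_assoc, H.e_comm b h]
  · rw [Equiv.swap_apply_of_ne_of_ne hbh hbx]
    simp only [holeStep, mul_assoc]
    rw [H.e_comm x b, H.t_e_comm_assoc hbh hbx, ← mul_assoc, H.e_comm h b, mul_assoc]

theorem step_mul_t_swap (H : SingularRelations e t) {h : ι} (x : ι) {c d : ι} (hc : c ≠ h)
    (hd : d ≠ h) :
    holeStep e t h x * t (Equiv.swap h x c) (Equiv.swap h x d) = t c d * holeStep e t h x := by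
  have key {d : ι} (hxh : x ≠ h) (hd : d ≠ h) (hdx : d ≠ x) :
      holeStep e t h x * t h d = t x d * holeStep e t h x := by
    calc holeStep e t h x * t h d = e h * (t h x * t h d) * e x := by
          simp only [holeStep, mul_assoc, H.t_e_comm h d x hxh hdx.symm]
      _ = t x d * e h * t h x * e x := by
          rw [H.t_triangle_right, H.t_e_comm x d h hxh.symm hd.symm]
          simp only [mul_assoc]
      _ = t x d * holeStep e t h x := by simp only [holeStep, mul_assoc]
  rcases eq_or_ne c d with rfl | hcd
  · simp only [H.t_self, mul_one, one_mul]
  rcases eq_or_ne c x with rfl | hcx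
  · rw [Equiv.swap_apply_right, Equiv.swap_apply_of_ne_of_ne hd hcd.symm]
    exact key hc hd hcd.symm
  rcases eq_or_ne d x with rfl | hdx
  · rw [Equiv.swap_apply_right, Equiv.swap_apply_of_ne_of_ne hc hcd, H.t_symm c h,
      H.t_symm c d]
    exact key hd hc hcd
  · rw [Equiv.swap_apply_of_ne_of_ne hd hdx, Equiv.swap_apply_of_ne_of_ne hc hcx]
    simp only [holeStep, mul_assoc]
    rw [← H.t_e_comm c d x hcx.symm hdx.symm, ← mul_assoc (t h x), H.t_comm h x c d,
      mul_assoc, ← mul_assoc (e h), ← H.t_e_comm c d h hc.symm hd.symm, mul_assoc]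

end SingularRelations

namespace HolePath

variable {ι M : Type*} [Monoid M] [DecidableEq ι] {e : ι → M} {t : ι → ι → M}
  {S : Finset ι} {k h : ι} {σ : Equiv.Perm ι} {m : M}

theorem mul_e (H : SingularRelations e t) (hp : HolePath e t S k h σ m) : m * e h = m := by
  cases hp with
  | nil => exact H.e_idem k
  | snoc x hx hp => rw [mul_assoc, H.step_mul_e]

theorem perm_apply (hp : HolePath e t S k h σ m) : σ k = h := by
  induction hp with
  | nil => rfl
  | snoc x hx _ ih => rw [Equiv.Perm.mul_apply, ih, Equiv.swap_apply_left]

theorem mem (hp : HolePath e t S k h σ m) (hk : k ∈ S) : h ∈ S := by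
  cases hp with
  | nil => exact hk
  | snoc x hx hp => exact hx

theorem perm_apply_notMem (hp : HolePath e t S k h σ m) (hk : k ∈ S) {a : ι} (ha : a ∉ S) :
    σ a = a := by
  induction hp with
  | nil => rfl
  | snoc x hx hp ih =>
    rw [Equiv.Perm.mul_apply, ih, Equiv.swap_apply_of_ne_of_ne]
    · exact fun h => ha (h ▸ hp.mem hk)
    · exact fun h => ha (h ▸ hx)

theorem single (H : SingularRelations e t) {x : ι} (hx : x ∈ S) :
    HolePath e t S k x (Equiv.swap k x) (holeStep e t k x) := by
  have := (nil : HolePath e t S k k 1 (e k)).snoc x hx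
  rwa [mul_one, H.e_mul_step] at this

theorem trans (H : SingularRelations e t) (hp : HolePath e t S k h σ m) {g : ι}
    {τ : Equiv.Perm ι} {m' : M} (hq : HolePath e t S h g τ m') :
    HolePath e t S k g (τ * σ) (m * m') := by
  induction hq with
  | nil => rwa [one_mul, hp.mul_e H]
  | snoc x hx _ ih => rw [mul_assoc, ← mul_assoc m]; exact ih.snoc x hx

theorem exists_inv (H : SingularRelations e t) (hk : k ∈ S) (hp : HolePath e t S k h σ m) :
    ∃ m', HolePath e t S h k σ⁻¹ m' ∧ m * m' = e k ∧ m' * m = e h := by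
  induction hp with
  | nil => exact ⟨e k, by rw [inv_one]; exact nil, H.e_idem k, H.e_idem k⟩
  | @snoc h σ m x hx hp ih =>
    obtain ⟨m', hm', h1, h2⟩ := ih
    refine ⟨holeStep e t x h * m', ?_, ?_, ?_⟩
    · rw [mul_inv_rev, Equiv.swap_inv, Equiv.swap_comm h x]
      exact (single H (hp.mem hk)).trans H hm'
    · rw [mul_assoc, ← mul_assoc (holeStep e t h x), H.step_back, ← mul_assoc, hp.mul_e H, h1]
    · rw [mul_assoc, ← mul_assoc m', h2, H.e_mul_step, H.step_back]

theorem mul_e_apply (H : SingularRelations e t) (hp : HolePath e t S k h σ m) (a : ι) :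
    m * e (σ a) = e a * m := by
  induction hp with
  | nil => exact H.e_comm k a
  | snoc x hx _ ih =>
    rw [mul_assoc, Equiv.Perm.mul_apply, H.step_mul_e_swap, ← mul_assoc, ih, mul_assoc]

theorem mul_t_apply (H : SingularRelations e t) (hp : HolePath e t S k h σ m) {a b : ι}
    (ha : a ≠ k) (hb : b ≠ k) : m * t (σ a) (σ b) = t a b * m := by
  induction hp with
  | nil => exact (H.t_e_comm a b k ha.symm hb.symm).symm
  | @snoc h σ m x hx hp ih =>
    have hne {a : ι} (ha : a ≠ k) : σ a ≠ h := by
      rw [← hp.perm_apply]; exact σ.injective.ne ha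
    rw [mul_assoc, Equiv.Perm.mul_apply, Equiv.Perm.mul_apply,
      H.step_mul_t_swap x (hne ha) (hne hb), ← mul_assoc, ih, mul_assoc]

/-- Peeling a position `p` off the set in which a path lives. -/
theorem peel (H : SingularRelations e t) {p : ι} (hk : k ∈ S) (hpS : p ∉ S)
    (hp : HolePath e t (insert p S) k h σ m) :
    HolePath e t S k h σ m ∨
    (h = p ∧ ∃ g τ m', HolePath e t S k g τ m' ∧ σ = Equiv.swap g p * τ ∧
      m = m' * holeStep e t g p) ∨
    (h ∈ S ∧ ∃ g τ m', HolePath e t S k g τ m' ∧ σ = Equiv.swap p h * (Equiv.swap g p * τ) ∧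
      m = m' * holeStep e t g p * holeStep e t p h) := by
  have hSp {a : ι} (ha : a ∈ S) : a ≠ p := fun h => hpS (h ▸ ha)
  induction hp with
  | nil => exact Or.inl nil
  | @snoc h σ m x hx hp ih =>
    rcases Finset.mem_insert.1 hx with rfl | hxS
    · refine Or.inr (Or.inl ⟨rfl, ?_⟩)
      rcases ih with ih | ⟨rfl, g, τ, m', hm', rfl, rfl⟩ | ⟨hh, g, τ, m', hm', rfl, rfl⟩
      · exact ⟨h, σ, m, ih, rfl, rfl⟩
      · refine ⟨g, τ, m', hm', ?_, ?_⟩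
        · rw [Equiv.swap_self]; rfl
        · rw [H.step_self, mul_assoc, H.step_mul_e]
      · refine ⟨g, τ, m', hm', ?_, ?_⟩
        · rw [Equiv.swap_comm h x, Equiv.swap_mul_self_mul]
        · rw [mul_assoc, H.step_back, mul_assoc, H.step_mul_e]
    · rcases ih with ih | ⟨rfl, g, τ, m', hm', rfl, rfl⟩ | ⟨hh, g, τ, m', hm', rfl, rfl⟩
      · exact Or.inl (ih.snoc x hxS)
      · exact Or.inr (Or.inr ⟨hxS, g, τ, m', hm', rfl, rfl⟩)
      · have hg := hm'.mem hk
        rcases eq_or_ne h g with rfl | hhg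
        · left
          rw [Equiv.swap_comm p h, Equiv.swap_mul_self_mul, mul_assoc m', H.step_back,
            hm'.mul_e H]
          exact hm'.snoc x hxS
        right; right
        refine ⟨hxS, ?_⟩
        rcases eq_or_ne x h with rfl | hxh
        · refine ⟨g, τ, m', hm', ?_, ?_⟩
          · rw [Equiv.swap_self]; rfl
          · rw [H.step_self, mul_assoc, H.step_mul_e]
        rcases eq_or_ne x g with rfl | hxg
        · refine ⟨h, _, _, hm'.snoc h hh, ?_, ?_⟩
          · simp only [← mul_assoc]
            congr 1
            ext y
            simp only [Equiv.Perm.mul_apply, Equiv.swap_apply_def]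
            grind
          · simp only [mul_assoc]
            congr 1
            simpa only [holeStep, mul_assoc] using
              H.hole_triangle p h x (hSp hh).symm hxh.symm (hSp hg).symm
        · refine ⟨g, _, _, ((hm'.snoc h hh).snoc x hxS).snoc g hg, ?_, ?_⟩
          · simp only [← mul_assoc]
            congr 1
            ext y
            simp only [Equiv.Perm.mul_apply, Equiv.swap_apply_def]
            grind
          · have hxp := hSp hxS
            have hhp := hSp hh
            have hgp := hSp hg
            let z := holeStep e t
            have h1 : z g p * z p h * z h x * z x g = z g h * z h x * z x p * z p g := by
              have h1 := H.hole_square p h g x hhp.symm hgp.symm hxp.symm hhg hxh.symm hxg.symm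
              have h2 := H.hole_square x p g h hxp hxg hxh hgp.symm hhp.symm hhg.symm
              exact h1.trans h2
            have h2 : z g p * z p x * z x g = z g x * z x p * z p g :=
              H.hole_triangle p x g hxp.symm hxg hgp.symm
            have h3 : z g h * z h x * z x g * z g p * z p x * z x g =
                z g p * z p h * z h x * z x g := by
              calc _ = z g h * z h x * z x g * (z g p * z p x * z x g) := by
                    simp only [mul_assoc]
                _ = z g h * z h x * (z x g * z g x) * z x p * z p g := by
                    rw [h2]; simp only [mul_assoc]
                _ = z g h * (z h x * e x) * z x p * z p g := by
                    rw [H.step_back x g, ← mul_assoc]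
                _ = _ := by rw [H.step_mul_e, h1]
            have h4 : z g p * z p h * z h x = z g h * z h x * z x g * z g p * z p x := by
              calc _ = z g p * z p h * (z h x * e x) := by rw [H.step_mul_e]
                _ = (z g p * z p h * z h x * z x g) * z g x := by
                    rw [← H.step_back x g]; simp only [z, mul_assoc]
                _ = z g h * z h x * z x g * z g p * (z p x * (z x g * z g x)) := by
                    rw [← h3]; simp only [mul_assoc]
                _ = _ := by rw [H.step_back x g, H.step_mul_e]
            simp only [mul_assoc] at h4 ⊢
            congr 1

/-- A path which fixes every position outside `A` can be chosen inside `A`. -/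
theorem restrict (H : SingularRelations e t) {A : Finset ι} (hk : k ∈ A) (hAS : A ⊆ S)
    (hp : HolePath e t S k h σ m) (hfix : ∀ a ∉ A, σ a = a) : HolePath e t A k h σ m := by
  obtain ⟨B, rfl⟩ : ∃ B, S = A ∪ B := ⟨S, (Finset.union_eq_right.2 hAS).symm⟩
  clear hAS
  induction B using Finset.induction_on with
  | empty => rwa [Finset.union_empty] at hp
  | insert p B _ ih =>
    apply ih
    rw [Finset.union_insert] at hp
    by_cases hpS : p ∈ A ∪ B
    · rwa [Finset.insert_eq_of_mem hpS] at hp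
    have hpA : p ∉ A := fun h => hpS (Finset.mem_union_left B h)
    have hkS : k ∈ A ∪ B := Finset.mem_union_left B hk
    have hσp := hfix p hpA
    rcases hp.peel H hkS hpS with hq | ⟨rfl, -⟩ | ⟨hh, g, τ, m', hq, rfl, rfl⟩
    · exact hq
    · exact absurd (σ.injective (hσp.trans hp.perm_apply.symm) ▸ hk) hpA
    · rw [Equiv.Perm.mul_apply, Equiv.Perm.mul_apply, hq.perm_apply_notMem hkS hpS,
        Equiv.swap_apply_right] at hσp
      have hg := hq.mem hkS
      have hgp : g ≠ p := fun h => hpS (h ▸ hg)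
      obtain rfl : g = h := by
        by_contra hgh
        exact hgp (by rwa [Equiv.swap_apply_of_ne_of_ne hgp hgh] at hσp)
      rw [Equiv.swap_comm p g, Equiv.swap_mul_self_mul, mul_assoc, H.step_back, hq.mul_e H]
      exact hq

end HolePath

theorem tProd_cons {ι M : Type*} [Monoid M] (t : ι → ι → M) (a b : ι)
    (l : List (ι × ι)) :
    tProd t ((a, b) :: l) = t a b * tProd t l := by
  simp [tProd]

theorem tProd_append {ι M : Type*} [Monoid M] (t : ι → ι → M)
    (l l' : List (ι × ι)) :
    tProd t (l ++ l') = tProd t l * tProd t l' := by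
  simp [tProd]

theorem eProd_singleton {ι M : Type*} [Monoid M] (e : ι → M) (i : ι) : eProd e {i} = e i := by
  simp [eProd]

namespace SingularRelations

variable {ι M : Type*} [Monoid M] {e : ι → M} {t : ι → ι → M}

theorem tProd_comm (H : SingularRelations e t) (a b : ι) (l : List (ι × ι)) :
    t a b * tProd t l = tProd t l * t a b := by
  refine Commute.list_prod_right _ _ fun x hx => ?_
  obtain ⟨q, -, rfl⟩ := List.mem_map.1 hx
  exact H.t_comm _ _ _ _

theorem tProd_mul_of_rel (H : SingularRelations e t) {l : List (ι × ι)} {a b : ι}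
    (hab : pairSetoid l a b) : tProd t l * t a b = tProd t l := by
  replace hab : Relation.EqvGen (fun a b => (a, b) ∈ l) a b := hab
  induction hab with
  | rel a b hab =>
    obtain ⟨l₁, l₂, rfl⟩ := List.append_of_mem hab
    rw [tProd_append, tProd_cons, mul_assoc, mul_assoc, ← H.tProd_comm, ← mul_assoc (t a b),
      H.t_idem]
  | refl a => rw [H.t_self, mul_one]
  | symm a b _ ih => rw [H.t_symm, ih]
  | trans a b c _ _ h₁ h₂ =>
    calc tProd t l * t a c = tProd t l * t b c * t c a := by rw [h₂, H.t_symm]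
      _ = tProd t l * (t a b * t b c) := by rw [mul_assoc, ← H.t_triangle]
      _ = tProd t l := by rw [← mul_assoc, h₁, h₂]

theorem t_mul_tProd_of_rel (H : SingularRelations e t) {l : List (ι × ι)} {a b : ι}
    (hab : pairSetoid l a b) : t a b * tProd t l = tProd t l := by
  rw [H.tProd_comm, H.tProd_mul_of_rel hab]

theorem tProd_mul_tProd (H : SingularRelations e t) {l l' : List (ι × ι)}
    (h : ∀ q ∈ l', pairSetoid l q.1 q.2) : tProd t l * tProd t l' = tProd t l := by
  induction l' with
  | nil => exact mul_one _
  | cons q l' ih =>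
    rw [tProd_cons, ← mul_assoc, H.tProd_mul_of_rel (h q List.mem_cons_self),
      ih fun q hq => h q (List.mem_cons_of_mem _ hq)]

theorem tProd_comm_tProd (H : SingularRelations e t) (l l' : List (ι × ι)) :
    tProd t l * tProd t l' = tProd t l' * tProd t l := by
  refine Commute.list_prod_right _ _ fun x hx => ?_
  obtain ⟨q, -, rfl⟩ := List.mem_map.1 hx
  exact (H.tProd_comm _ _ _).symm

theorem tProd_congr (H : SingularRelations e t) {l l' : List (ι × ι)}
    (h : pairSetoid l = pairSetoid l') : tProd t l = tProd t l' := by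
  have hrel {l : List (ι × ι)} : ∀ q ∈ l, pairSetoid l q.1 q.2 := fun q hq =>
    Relation.EqvGen.rel _ _ hq
  rw [← H.tProd_mul_tProd (l := l) (l' := l') (h ▸ hrel), H.tProd_comm_tProd,
    H.tProd_mul_tProd (h ▸ hrel)]

/-- A product of `t`s can be rewritten so that a given index occurs in at most one factor. -/
theorem exists_tProd_isolate [DecidableEq ι] (H : SingularRelations e t) (j : ι)
    (l : List (ι × ι)) :
    ∃ l', e j * tProd t l' = tProd t l' * e j ∧
      ∃ m, tProd t l = t j m * tProd t l' := by
  suffices ∃ l', (∀ q ∈ l', q.1 ≠ j ∧ q.2 ≠ j) ∧ ∃ m, tProd t l = t j m * tProd t l' by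
    obtain ⟨l', h, hm⟩ := this
    refine ⟨l', Commute.list_prod_right _ _ fun x hx => ?_, hm⟩
    obtain ⟨q, hq, rfl⟩ := List.mem_map.1 hx
    exact (H.t_e_comm _ _ _ (h q hq).1.symm (h q hq).2.symm).symm
  have main (b m : ι) {l' : List (ι × ι)} (hl' : ∀ q ∈ l', q.1 ≠ j ∧ q.2 ≠ j) :
      ∃ l'', (∀ q ∈ l'', q.1 ≠ j ∧ q.2 ≠ j) ∧
        ∃ m', t j b * (t j m * tProd t l') = t j m' * tProd t l'' := by
    rcases eq_or_ne b j with rfl | hb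
    · exact ⟨l', hl', m, by rw [H.t_self, one_mul]⟩
    rcases eq_or_ne m j with rfl | hm
    · exact ⟨l', hl', b, by rw [H.t_self, one_mul]⟩
    · refine ⟨(b, m) :: l', ?_, b, ?_⟩
      · rintro q (_ | ⟨_, hq⟩)
        exacts [⟨hb, hm⟩, hl' q hq]
      · rw [← mul_assoc, H.t_triangle_right, tProd_cons, ← mul_assoc, H.t_comm]
  induction l with
  | nil => exact ⟨[], by simp, j, by rw [H.t_self, one_mul]⟩
  | cons q l ih =>
    obtain ⟨a, b⟩ := q
    obtain ⟨l', hl', m, hm⟩ := ih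
    rw [tProd_cons, hm]
    rcases eq_or_ne a j with rfl | ha
    · exact main b m hl'
    rcases eq_or_ne b j with rfl | hb
    · rw [H.t_symm]
      exact main a m hl'
    · refine ⟨(a, b) :: l', ?_, m, ?_⟩
      · rintro q (_ | ⟨_, hq⟩)
        exacts [⟨ha, hb⟩, hl' q hq]
      · rw [tProd_cons, ← mul_assoc, H.t_comm, mul_assoc]

theorem eProd_comm (H : SingularRelations e t) (A : Finset ι) (i : ι) :
    e i * eProd e A = eProd e A * e i := by
  refine Commute.list_prod_right _ _ fun x hx => ?_
  obtain ⟨j, -, rfl⟩ := List.mem_map.1 hx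
  exact H.e_comm i j

theorem t_eProd_comm (H : SingularRelations e t) {A : Finset ι} {a b : ι} (ha : a ∉ A)
    (hb : b ∉ A) : t a b * eProd e A = eProd e A * t a b := by
  refine Commute.list_prod_right _ _ fun x hx => ?_
  obtain ⟨j, hj, rfl⟩ := List.mem_map.1 hx
  rw [Finset.mem_toList] at hj
  exact H.t_e_comm a b j (fun h => ha (h ▸ hj)) (fun h => hb (h ▸ hj))

variable [DecidableEq ι]

theorem eProd_cons (H : SingularRelations e t) {A : Finset ι} {a : ι} (ha : a ∉ A) :
    eProd e (insert a A) = e a * eProd e A := by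
  rw [eProd, ((Finset.toList_insert ha).map e).prod_eq', List.map_cons, List.prod_cons, eProd]
  refine List.Pairwise.map _ (R := fun _ _ => True) (fun i j _ => H.e_comm i j) ?_
  exact List.pairwise_of_forall fun _ _ => trivial

theorem e_mul_eProd (H : SingularRelations e t) {A : Finset ι} {a : ι} (ha : a ∈ A) :
    e a * eProd e A = eProd e A := by
  rw [← Finset.insert_erase ha, H.eProd_cons (Finset.notMem_erase a A), H.e_idem_assoc]

theorem eProd_mul_e (H : SingularRelations e t) {A : Finset ι} {a : ι} (ha : a ∈ A) :
    eProd e A * e a = eProd e A := by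
  rw [← H.eProd_comm, H.e_mul_eProd ha]

theorem eProd_insert (H : SingularRelations e t) (A : Finset ι) (a : ι) :
    eProd e (insert a A) = e a * eProd e A := by
  by_cases ha : a ∈ A
  · rw [Finset.insert_eq_of_mem ha, H.e_mul_eProd ha]
  · exact H.eProd_cons ha

theorem eProd_erase (H : SingularRelations e t) {A : Finset ι} {a : ι} (ha : a ∈ A) :
    eProd e A = e a * eProd e (A.erase a) := by
  rw [← H.eProd_insert, Finset.insert_erase ha]

theorem eProd_mul_step (H : SingularRelations e t) {A : Finset ι} {i j : ι} (hi : i ∈ A)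
    (hj : j ∈ A) : eProd e A * holeStep e t i j = eProd e A := by
  rw [← H.eProd_mul_e hj, mul_assoc, holeStep, ← mul_assoc (e j), ← mul_assoc (e j),
    H.e_comm j i, mul_assoc (e i), mul_assoc (e i), H.e_t_e_right, ← H.e_comm, ← mul_assoc,
    H.eProd_mul_e hj, H.eProd_mul_e hi]

end SingularRelations

namespace HolePath

variable {ι M : Type*} [Monoid M] [DecidableEq ι] {e : ι → M} {t : ι → ι → M}
  {S : Finset ι} {k h : ι} {σ : Equiv.Perm ι} {m : M}

theorem eProd_mul (H : SingularRelations e t) (hk : k ∈ S) (hp : HolePath e t S k h σ m) :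
    eProd e S * m = eProd e S := by
  induction hp with
  | nil => exact H.eProd_mul_e hk
  | snoc x hx hp ih => rw [← mul_assoc, ih, H.eProd_mul_step (hp.mem hk) hx]

theorem exists_path [Fintype ι] (H : SingularRelations e t) (k : ι) (σ : Equiv.Perm ι) :
    ∃ m, HolePath e t Finset.univ k (σ k) σ m := by
  induction σ using Equiv.Perm.swap_induction_on with
  | one => exact ⟨e k, nil⟩
  | swap_mul σ i j hij ih =>
    obtain ⟨m, hm⟩ := ih
    have hmem (x : ι) : x ∈ Finset.univ := Finset.mem_univ x
    suffices ∃ m' h', HolePath e t Finset.univ (σ k) h' (Equiv.swap i j) m' by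
      obtain ⟨m', h', hm'⟩ := this
      have hq := hm.trans H hm'
      exact ⟨m * m', hq.perm_apply ▸ hq⟩
    generalize σ k = h
    rcases eq_or_ne h i with rfl | hhi
    · exact ⟨_, _, single H (hmem j)⟩
    rcases eq_or_ne h j with rfl | hhj
    · exact ⟨_, _, Equiv.swap_comm h i ▸ single H (hmem i)⟩
    · refine ⟨holeStep e t h i * holeStep e t i j * holeStep e t j h, h, ?_⟩
      convert ((single (t := t) H (hmem i)).snoc j (hmem j)).snoc h (hmem h) using 1
      ext x
      simp only [Equiv.Perm.mul_apply, Equiv.swap_apply_def]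
      grind

theorem eProd_mul_snoc [Fintype ι] (H : SingularRelations e t) {A : Finset ι} {a : ι}
    (ha : a ∈ A) (hp : HolePath e t Finset.univ k h σ m) :
    eProd e A * (m * holeStep e t h (σ a)) = eProd e A * m := by
  have h1 : eProd e A * m = eProd e A * m * e (σ a) := by
    rw [mul_assoc, hp.mul_e_apply H, ← mul_assoc, H.eProd_mul_e ha]
  have h2 : e (σ a) * holeStep e t h (σ a) = e h * e (σ a) := by
    rw [holeStep, ← mul_assoc, ← mul_assoc, H.e_comm, mul_assoc, mul_assoc,
      ← mul_assoc (e (σ a)), H.e_t_e_right]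
  rw [← mul_assoc, h1, mul_assoc, h2, mul_assoc, H.e_comm h, ← mul_assoc m, ← mul_assoc,
    ← mul_assoc, ← h1, mul_assoc, hp.mul_e H]

/-- After multiplying by `e i` for all `i ∈ A`, a path depends only on its action outside `A`. -/
theorem eProd_mul_congr [Fintype ι] (H : SingularRelations e t) {A : Finset ι} {k' h' : ι}
    {σ' : Equiv.Perm ι} {m' : M} (hk : k ∈ A) (hk' : k' ∈ A)
    (hp : HolePath e t Finset.univ k h σ m) (hp' : HolePath e t Finset.univ k' h' σ' m')
    (hσ : ∀ a ∉ A, σ a = σ' a) : eProd e A * m = eProd e A * m' := by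
  obtain ⟨m₁, hm₁, -, hmm⟩ := hp.exists_inv H (Finset.mem_univ k)
  obtain ⟨a, rfl⟩ : ∃ a, σ' a = h := σ'.surjective h
  have haA : a ∈ A := by
    by_contra ha
    have : σ a = σ k := (hσ a ha).trans hp.perm_apply.symm
    exact ha (σ.injective this ▸ hk)
  have hq := ((single (x := k') (k := k) H (Finset.mem_univ k')).trans H hp').snoc (σ' a)
    (Finset.mem_univ _)
  have hr := (hq.trans H hm₁).restrict H hk (Finset.subset_univ A) (fun x hx => by
    have hxk : x ≠ k := fun h => hx (h ▸ hk)
    have hxk' : x ≠ k' := fun h => hx (h ▸ hk')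
    have hxa : x ≠ a := fun h => hx (h ▸ haA)
    rw [Equiv.Perm.mul_apply, Equiv.Perm.mul_apply, Equiv.Perm.mul_apply,
      Equiv.swap_apply_of_ne_of_ne hxk hxk', Equiv.swap_apply_of_ne_of_ne,
      ← hσ x hx]
    · exact σ.symm_apply_apply x
    · rw [← hp'.perm_apply]; exact σ'.injective.ne hxk'
    · exact σ'.injective.ne hxa)
  have hs := hr.eProd_mul H hk
  calc eProd e A * m = eProd e A * (holeStep e t k k' * m' * holeStep e t h' (σ' a) * m₁) * m := by
        rw [hs]
    _ = eProd e A * holeStep e t k k' * m' * holeStep e t h' (σ' a) * (m₁ * m) := by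
        simp only [mul_assoc]
    _ = eProd e A * (m' * holeStep e t h' (σ' a)) := by
        rw [hmm, mul_assoc _ (holeStep e t h' (σ' a)), H.step_mul_e, H.eProd_mul_step hk hk',
          mul_assoc]
    _ = eProd e A * m' := hp'.eProd_mul_snoc H haA

end HolePath

/-- `Represents e t l A σ l' m` says that `m` factorizes as a product of `t`s indexed by `l`, a
partial permutation with domain `Aᶜ` and action `σ`, and a product of `t`s indexed by `l'`. -/
def Represents {ι M : Type*} [Monoid M] [DecidableEq ι] [Fintype ι] (e : ι → M) (t : ι → ι → M)
    (l : List (ι × ι)) (A : Finset ι) (σ : Equiv.Perm ι) (l' : List (ι × ι)) (m : M) : Prop :=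
  ∃ k ∈ A, ∃ h p, HolePath e t Finset.univ k h σ p ∧ m = tProd t l * (eProd e A * p) * tProd t l'

namespace Represents

variable {ι M : Type*} [Monoid M] [DecidableEq ι] [Fintype ι] {e : ι → M} {t : ι → ι → M}
  {l l' : List (ι × ι)} {A : Finset ι} {σ : Equiv.Perm ι} {m : M}

theorem unique (H : SingularRelations e t) {l₁ l₁' : List (ι × ι)} {σ₁ : Equiv.Perm ι} {m₁ : M}
    (h : Represents e t l A σ l' m) (h₁ : Represents e t l₁ A σ₁ l₁' m₁)
    (hl : pairSetoid l = pairSetoid l₁) (hl' : pairSetoid l' = pairSetoid l₁')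
    (hσ : ∀ a ∉ A, σ a = σ₁ a) : m = m₁ := by
  obtain ⟨k, hk, g, p, hp, rfl⟩ := h
  obtain ⟨k₁, hk₁, g₁, p₁, hp₁, rfl⟩ := h₁
  rw [H.tProd_congr hl, H.tProd_congr hl', hp.eProd_mul_congr H hk hk₁ hp₁ hσ]

theorem t_mul_comm (H : SingularRelations e t) {k h a b : ι} (hk : k ∈ A)
    (hp : HolePath e t Finset.univ k h σ m) (ha : a ∉ A) (hb : b ∉ A) :
    t a b * (eProd e A * m) = eProd e A * m * t (σ a) (σ b) := by
  rw [mul_assoc, hp.mul_t_apply H (fun h : a = k => ha (h ▸ hk)) (fun h : b = k => hb (h ▸ hk)),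
    ← mul_assoc,
    ← mul_assoc, H.t_eProd_comm ha hb]

theorem t_mul_merge (H : SingularRelations e t) {k h a b : ι} (hk : k ∈ A)
    (hp : HolePath e t Finset.univ k h σ m) (ha : a ∉ A) (hb : b ∉ A) (hab : a ≠ b) :
    t a b * (eProd e (insert b A) * m) * t (σ a) (σ b) = t a b * (eProd e A * m) := by
  rw [H.eProd_insert, mul_assoc (e b), mul_assoc, mul_assoc, ← t_mul_comm H hk hp ha hb,
    ← mul_assoc, ← mul_assoc, H.t_e_t_right hab]

theorem merge_upper (H : SingularRelations e t) (h : Represents e t l A σ l' m) {a b : ι}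
    (ha : a ∉ A) (hb : b ∉ A) (hab : a ≠ b) (hl : pairSetoid l a b) :
    Represents e t l (insert b A) σ ((σ a, σ b) :: l') m := by
  obtain ⟨k, hk, g, p, hp, rfl⟩ := h
  refine ⟨k, Finset.mem_insert_of_mem hk, g, p, hp, ?_⟩
  rw [tProd_cons, ← H.tProd_mul_of_rel hl, mul_assoc (tProd t l),
    ← t_mul_merge H hk hp ha hb hab]
  simp only [mul_assoc]

theorem merge_lower (H : SingularRelations e t) (h : Represents e t l A σ l' m) {a b : ι}
    (ha : a ∉ A) (hb : b ∉ A) (hab : a ≠ b) (hl : pairSetoid l' (σ a) (σ b)) :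
    Represents e t (l ++ [(a, b)]) (insert b A) σ l' m := by
  obtain ⟨k, hk, g, p, hp, rfl⟩ := h
  refine ⟨k, Finset.mem_insert_of_mem hk, g, p, hp, ?_⟩
  rw [tProd_append, tProd_cons, ← H.t_mul_tProd_of_rel hl, ← mul_assoc, mul_assoc (tProd t l),
    ← t_mul_comm H hk hp ha hb, ← t_mul_merge H hk hp ha hb hab]
  simp only [mul_assoc, tProd, List.map_nil, List.prod_nil, one_mul]

theorem replace_upper (H : SingularRelations e t) (h : Represents e t l A σ l' m) {c d : ι}
    (hc : c ∉ A) (hd : d ∈ A) (hl : pairSetoid l c d) :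
    ∃ τ : Equiv.Perm ι, Represents e t l (insert c (A.erase d)) τ l' m ∧ τ d = σ c ∧
      ∀ x ∉ A, x ≠ c → τ x = σ x := by
  obtain ⟨k, hk, g, p, hp, rfl⟩ := h
  have hcd : c ≠ d := fun h => hc (h ▸ hd)
  have hck : c ≠ k := fun h => hc (h ▸ hk)
  have hq := (HolePath.single (k := d) (S := Finset.univ) H (Finset.mem_univ k)).trans H hp
  have hr := (HolePath.single (k := c) (S := Finset.univ) H (Finset.mem_univ d)).trans H hq
  refine ⟨_, ⟨c, Finset.mem_insert_self _ _, g, _, hr, ?_⟩, ?_, ?_⟩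
  · have hcB : c ∉ A.erase d := fun h => hc (Finset.mem_of_mem_erase h)
    have hdB : d ∉ A.erase d := Finset.notMem_erase d A
    congr 1
    rw [← H.tProd_mul_of_rel hl, mul_assoc, mul_assoc]
    congr 1
    rw [← H.eProd_mul_step hd hk, mul_assoc (eProd e A)]
    generalize holeStep e t d k * p = q
    rw [H.eProd_erase hd, H.eProd_insert, H.eProd_comm, H.eProd_comm, mul_assoc, mul_assoc,
      ← mul_assoc (t c d), ← mul_assoc (t c d), H.t_eProd_comm hcB hdB, mul_assoc, mul_assoc,
      holeStep]
    congr 1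
    simp only [mul_assoc, H.e_idem_assoc]
    rw [H.t_e_t_assoc hcd]
  · simp [hcd, hck, Equiv.swap_apply_of_ne_of_ne]
  · intro x hx hxc
    have hxd : x ≠ d := fun h => hx (h ▸ hd)
    have hxk : x ≠ k := fun h => hx (h ▸ hk)
    simp [hxc, hxd, hxk, Equiv.swap_apply_of_ne_of_ne]

theorem replace_lower (H : SingularRelations e t) (h : Represents e t l A σ l' m) {c d : ι}
    (hc : c ∉ A) (hd : d ∈ A) (hl : pairSetoid l' (σ c) (σ d)) :
    ∃ τ : Equiv.Perm ι, Represents e t l A τ l' m ∧ τ c = σ d ∧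
      ∀ x ∉ A, x ≠ c → τ x = σ x := by
  obtain ⟨k, hk, g, p, hp, rfl⟩ := h
  have hcd : σ c ≠ σ d := fun h => hc (σ.injective h ▸ hd)
  have hcg : σ c ≠ g := fun h => hc (σ.injective (h.trans hp.perm_apply.symm) ▸ hk)
  have hq := hp.snoc (σ d) (Finset.mem_univ _)
  have hr := hq.snoc (σ c) (Finset.mem_univ _)
  refine ⟨_, ⟨k, hk, _, _, hr, ?_⟩, ?_, ?_⟩
  · have hq' := hq.mul_e H
    rw [← hp.eProd_mul_snoc H hd, ← H.t_mul_tProd_of_rel hl]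
    generalize p * holeStep e t g (σ d) = q at *
    rw [← hq', H.t_symm]
    simp only [mul_assoc, holeStep, H.e_idem_assoc]
    rw [← mul_assoc (e (σ c)), ← mul_assoc (t (σ d) (σ c)), ← mul_assoc (t (σ d) (σ c)),
      H.t_e_t_right hcd.symm]
  · rw [Equiv.Perm.mul_apply, Equiv.Perm.mul_apply, Equiv.swap_apply_of_ne_of_ne hcg hcd,
      Equiv.swap_apply_right]
  · intro x hx hxc
    have hxd : σ x ≠ σ d := fun h => hx (σ.injective h ▸ hd)
    have hxg : σ x ≠ g := fun h => hx (σ.injective (h.trans hp.perm_apply.symm) ▸ hk)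
    rw [Equiv.Perm.mul_apply, Equiv.Perm.mul_apply, Equiv.swap_apply_of_ne_of_ne hxg hxd,
      Equiv.swap_apply_of_ne_of_ne hxd (σ.injective.ne hxc)]

theorem mul_t (h : Represents e t l A σ l' m) (i j : ι) :
    Represents e t l A σ (l' ++ [(i, j)]) (m * t i j) := by
  obtain ⟨k, hk, g, p, hp, rfl⟩ := h
  exact ⟨k, hk, g, p, hp, by simp [tProd, mul_assoc]⟩

theorem e_self (H : SingularRelations e t) (i : ι) : Represents e t [] {i} 1 [] (e i) :=
  ⟨i, Finset.mem_singleton_self i, i, e i, .nil, by simp [tProd, eProd_singleton, H.e_idem]⟩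

theorem t_self (H : SingularRelations e t) {i j : ι} (hij : i ≠ j) :
    Represents e t [(i, j)] {i} 1 [(i, j)] (t i j) :=
  ⟨i, Finset.mem_singleton_self i, i, e i, .nil, by
    simp [tProd, eProd_singleton, H.e_idem, H.t_e_t i j hij]⟩

theorem mul_e (H : SingularRelations e t) (h : Represents e t l A σ l' m) (j : ι) :
    ∃ l₁ A₁ σ₁ l₁', Represents e t l₁ A₁ σ₁ l₁' (m * e j) := by
  obtain ⟨k, hk, g, p, hp, rfl⟩ := h
  obtain ⟨l'', hcomm, i, hi⟩ := H.exists_tProd_isolate j l'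
  obtain ⟨b, rfl⟩ := σ.surjective j
  obtain ⟨c, rfl⟩ := σ.surjective i
  rw [hi]
  have hmul : tProd t l * (eProd e A * p) * (t (σ b) (σ c) * tProd t l'') * e (σ b) =
      tProd t l * (eProd e A * (p * (t (σ b) (σ c) * e (σ b)))) * tProd t l'' := by
    simp only [mul_assoc, hcomm]
  rw [hmul]
  rcases eq_or_ne b c with rfl | hbc
  · refine ⟨l, insert b A, σ, l'', k, Finset.mem_insert_of_mem hk, g, p, hp, ?_⟩
    rw [H.t_self, one_mul, hp.mul_e_apply H, ← mul_assoc (eProd e A), ← H.eProd_comm,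
      H.eProd_insert]
  by_cases hb : b ∈ A
  · refine ⟨l, A, σ, l'', k, hk, g, p, hp, ?_⟩
    have h1 : eProd e A * p = eProd e A * p * e (σ b) := by
      rw [mul_assoc, hp.mul_e_apply H, ← mul_assoc, H.eProd_mul_e hb]
    rw [← mul_assoc (eProd e A), h1, mul_assoc _ (e (σ b)), ← mul_assoc (e (σ b)), H.e_t_e]
  by_cases hc : c ∈ A
  · have hq := hp.snoc (σ c) (Finset.mem_univ _)
    refine ⟨l, A, _, l'', k, hk, _, _, hq.snoc (σ b) (Finset.mem_univ _), ?_⟩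
    rw [← mul_assoc (eProd e A), ← hp.eProd_mul_snoc H hc, ← hq.mul_e H, H.t_symm (σ b)]
    simp only [holeStep, mul_assoc, H.e_idem_assoc]
  · refine ⟨l ++ [(b, c)], insert b A, σ, l'', k, Finset.mem_insert_of_mem hk, g, p, hp, ?_⟩
    rw [← mul_assoc p, ← mul_assoc (eProd e A), ← mul_assoc (eProd e A), ← t_mul_comm H hk hp hb hc]
    have h1 : t b c * (eProd e A * p) * e (σ b) = t b c * (eProd e (insert b A) * p) := by
      rw [mul_assoc, mul_assoc, hp.mul_e_apply H, ← mul_assoc (eProd e A), ← H.eProd_comm,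
        H.eProd_insert]
    rw [h1]
    simp [tProd, mul_assoc]

end Represents

/-- Every represented element has a representation in which the domain and the image of the
partial permutation consist of minimal elements of their classes. -/
theorem Represents.exists_canonical {n : ℕ} {M : Type*} [Monoid M] {e : Fin n → M}
    {t : Fin n → Fin n → M} (H : SingularRelations e t) {l l' : List (Fin n × Fin n)}
    {A : Finset (Fin n)} {σ : Equiv.Perm (Fin n)} {m : M} (h : Represents e t l A σ l' m) :
    ∃ l A σ l', Represents e t l A σ l' m ∧ ∀ c ∉ A,
      (∀ d, pairSetoid l c d → c ≤ d) ∧ ∀ y, pairSetoid l' (σ c) y → σ c ≤ y := by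
  induction hw : ∑ x ∈ Aᶜ, (1 + x.val + (σ x).val) using Nat.strong_induction_on
    generalizing l A σ l' with | _ w ih =>
  subst hw
  by_cases hcan : ∀ c ∉ A,
      (∀ d, pairSetoid l c d → c ≤ d) ∧ ∀ y, pairSetoid l' (σ c) y → σ c ≤ y
  · exact ⟨l, A, σ, l', h, hcan⟩
  push Not at hcan
  obtain ⟨c, hc, hcan⟩ := hcan
  have hcA : c ∈ Aᶜ := Finset.mem_compl.2 hc
  have hmerge {d : Fin n} (hd : d ∉ A) :
      ∑ x ∈ (insert d A)ᶜ, (1 + x.val + (σ x).val) < ∑ x ∈ Aᶜ, (1 + x.val + (σ x).val) := by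
    rw [Finset.compl_insert, ← Finset.add_sum_erase _ _ (Finset.mem_compl.2 hd)]
    lia
  have hcongr {τ : Equiv.Perm (Fin n)} (hτ : ∀ x ∉ A, x ≠ c → τ x = σ x) :
      ∑ x ∈ Aᶜ.erase c, (1 + x.val + (τ x).val) = ∑ x ∈ Aᶜ.erase c, (1 + x.val + (σ x).val) := by
    refine Finset.sum_congr rfl fun x hx => ?_
    rw [Finset.mem_erase, Finset.mem_compl] at hx
    rw [hτ x hx.2 hx.1]
  by_cases hup : ∃ d, pairSetoid l c d ∧ d < c
  · obtain ⟨d, hcd, hlt⟩ := hup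
    by_cases hd : d ∈ A
    · obtain ⟨τ, hτ, hτd, hτx⟩ := h.replace_upper H hc hd hcd
      refine ih _ ?_ hτ rfl
      have hdc : d ∉ Aᶜ.erase c := fun h =>
        Finset.mem_compl.1 (Finset.mem_of_mem_erase h) hd
      rw [Finset.compl_insert, Finset.compl_erase, Finset.erase_insert_of_ne hlt.ne,
        Finset.sum_insert hdc, hcongr hτx, hτd, ← Finset.add_sum_erase _ _ hcA]
      have : d.val < c.val := hlt
      lia
    · exact ih _ (hmerge hd) (h.merge_upper H hc hd hlt.ne' hcd) rfl
  · obtain ⟨y, hcy, hlt⟩ := hcan fun d hd => not_lt.1 fun h => hup ⟨d, hd, h⟩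
    obtain ⟨d, rfl⟩ := σ.surjective y
    have hdc : c ≠ d := fun h => hlt.ne (h ▸ rfl)
    by_cases hd : d ∈ A
    · obtain ⟨τ, hτ, hτc, hτx⟩ := h.replace_lower H hc hd hcy
      refine ih _ ?_ hτ rfl
      rw [← Finset.add_sum_erase _ _ hcA, hcongr hτx, hτc,
        ← Finset.add_sum_erase _ (fun x => 1 + x.val + (σ x).val) hcA]
      have : (σ d).val < (σ c).val := hlt
      lia
    · exact ih _ (hmerge hd) (h.merge_lower H hc hd hdc hcy) rfl

/-- Binary relations on `X`, as a monoid under composition. -/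
def BinRel (X : Type*) := X → X → Prop

instance {X : Type*} : Monoid (BinRel X) where
  mul := Relation.Comp
  one := Eq
  mul_assoc _ _ _ := Relation.comp_assoc
  one_mul _ := Relation.eq_comp
  mul_one _ := Relation.comp_eq

namespace BinRel

variable {ι X : Type*}

theorem mul_apply (r s : BinRel X) (f g : X) : (r * s) f g ↔ ∃ u, r f u ∧ s u g := Iff.rfl

theorem one_apply (f g : X) : (1 : BinRel X) f g ↔ f = g := Iff.rfl

theorem ext {r s : BinRel X} (h : ∀ f g, r f g ↔ s f g) : r = s :=
  funext fun f => funext fun g => propext (h f g)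

/-- The relation on `2`-colourings of `ι` induced by `ē_i`. -/
def cut (i : ι) : BinRel (ι → Prop) := fun f g => ∀ x ≠ i, f x = g x

/-- The relation on `2`-colourings of `ι` induced by `t̄_{ij}`. -/
def join (i j : ι) : BinRel (ι → Prop) := fun f g => f = g ∧ f i = f j

/-- The relation on `2`-colourings of `ι` induced by a partial permutation undefined at `k`. -/
def shift (k : ι) (σ : Equiv.Perm ι) : BinRel (ι → Prop) := fun f g => ∀ x ≠ k, f x = g (σ x)

theorem shift_mul_shift {k h : ι} {σ : Equiv.Perm ι} (hk : σ k = h) (τ : Equiv.Perm ι) :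
    shift k σ * shift h τ = shift k (τ * σ) := by
  subst hk
  refine ext fun f g => ⟨?_, fun h => ⟨g ∘ τ, h, fun _ _ => rfl⟩⟩
  rintro ⟨u, h₁, h₂⟩ x hx
  rw [h₁ x hx, h₂ _ (σ.injective.ne hx), Equiv.Perm.mul_apply]

variable [DecidableEq ι]

theorem holeStep_eq_shift (h x : ι) :
    holeStep cut join h x = shift h (Equiv.swap h x) := by
  refine ext fun f g => ⟨?_, fun hfg => ?_⟩
  · rintro ⟨u, ⟨v, hv, rfl, huv⟩, hu⟩ y hy
    rcases eq_or_ne y x with rfl | hyx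
    · rw [Equiv.swap_apply_right, hv y hy, ← huv, hu h hy.symm]
    · rw [Equiv.swap_apply_of_ne_of_ne hy hyx, hv y hy, hu y hyx]
  · have hu : ∀ y ≠ h, f y = Function.update f h (f x) y := fun y hy =>
      (Function.update_of_ne hy _ _).symm
    refine ⟨_, ⟨_, hu, rfl, ?_⟩, fun y hy => ?_⟩
    · rcases eq_or_ne x h with rfl | hx
      · rfl
      · rw [← hu x hx, Function.update_self]
    · rcases eq_or_ne y h with rfl | hyh
      · rw [Function.update_self, hfg x hy.symm, Equiv.swap_apply_right]
      · rw [← hu y hyh, hfg y hyh, Equiv.swap_apply_of_ne_of_ne hyh hy]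

theorem singularRelations : SingularRelations (cut (ι := ι)) join where
  e_idem i := ext fun f g => ⟨fun ⟨u, h₁, h₂⟩ x hx => (h₁ x hx).trans (h₂ x hx),
    fun h => ⟨f, fun _ _ => rfl, h⟩⟩
  e_comm i j := by
    have key (i j : ι) (f g : ι → Prop) (h : (cut i * cut j) f g) : (cut j * cut i) f g := by
      obtain ⟨u, h₁, h₂⟩ := h
      refine ⟨fun x => if x = j then g x else f x, fun x hx => by simp [hx], fun x hx => ?_⟩
      by_cases hxj : x = j
      · simp [hxj]
      · simp [hxj, h₁ x hx, h₂ x hxj]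
    exact ext fun f g => ⟨key i j f g, key j i f g⟩
  t_self i := ext fun f g => ⟨And.left, fun h => ⟨h, rfl⟩⟩
  t_symm i j := ext fun f g => and_congr_right fun _ => eq_comm
  t_idem i j := ext fun f g => by
    simp only [mul_apply, join]; grind
  t_comm i j k l := ext fun f g => by
    simp only [mul_apply, join]; grind
  t_triangle i j k := ext fun f g => by
    simp only [mul_apply, join]; grind
  t_e_comm i j k hi hj := ext fun f g => by
    simp only [mul_apply, join, cut]
    constructor
    · rintro ⟨u, ⟨rfl, hij⟩, h⟩
      exact ⟨g, h, rfl, by rw [← h i hi.symm, ← h j hj.symm, hij]⟩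
    · rintro ⟨u, h, rfl, hij⟩
      exact ⟨f, ⟨rfl, by rw [h i hi.symm, h j hj.symm, hij]⟩, h⟩
  t_e_t i j hij := ext fun f g => by
    simp only [mul_apply, join, cut]
    constructor
    · rintro ⟨u, ⟨v, ⟨rfl, hf⟩, h⟩, rfl, hu⟩
      refine ⟨funext fun x => ?_, hf⟩
      rcases eq_or_ne x i with rfl | hx
      · rw [hf, hu, h j hij.symm]
      · exact h x hx
    · rintro ⟨rfl, hf⟩
      exact ⟨f, ⟨f, ⟨rfl, hf⟩, fun _ _ => rfl⟩, rfl, hf⟩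
  e_t_e i j := ext fun f g => by
    simp only [mul_apply, join, cut]
    constructor
    · rintro ⟨u, ⟨v, h, rfl, -⟩, h'⟩ x hx
      rw [h x hx, h' x hx]
    · intro h
      have hu : ∀ y ≠ i, f y = Function.update f i (f j) y := fun y hy =>
        (Function.update_of_ne hy _ _).symm
      refine ⟨_, ⟨_, hu, rfl, ?_⟩, fun x hx => by rw [← hu x hx, h x hx]⟩
      rcases eq_or_ne j i with rfl | hj
      · rfl
      · rw [← hu j hj, Function.update_self]
  hole_triangle i j k hij hjk hik := by
    change holeStep cut join k i * holeStep cut join i j * holeStep cut join j k =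
      holeStep cut join k j * holeStep cut join j i * holeStep cut join i k
    simp only [holeStep_eq_shift]
    rw [shift_mul_shift (by simp), shift_mul_shift (by simp), shift_mul_shift (by simp),
      shift_mul_shift (by simp)]
    congr 1
    ext x
    simp only [Equiv.Perm.mul_apply, Equiv.swap_apply_def]
    grind
  hole_square i j k l hij hik hil hjk hjl hkl := by
    change holeStep cut join k i * holeStep cut join i j * holeStep cut join j l *
      holeStep cut join l k = holeStep cut join k l * holeStep cut join l i *
      holeStep cut join i j * holeStep cut join j k
    simp only [holeStep_eq_shift]
    rw [shift_mul_shift (by simp), shift_mul_shift (by simp), shift_mul_shift (by simp),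
      shift_mul_shift (by simp), shift_mul_shift (by simp), shift_mul_shift (by simp)]
    congr 1
    ext x
    simp only [Equiv.Perm.mul_apply, Equiv.swap_apply_def]
    grind

end BinRel

section Evaluation

variable {ι M : Type*} [Monoid M] {e : ι → M} {t : ι → ι → M} {F : M →* BinRel (ι → Prop)}

theorem tProd_eval (ht : ∀ i j, F (t i j) = BinRel.join i j) (l : List (ι × ι))
    (f g : ι → Prop) :
    F (tProd t l) f g ↔ f = g ∧ ∀ a b, pairSetoid l a b → f a = f b := by
  have main : F (tProd t l) f g ↔ f = g ∧ ∀ q ∈ l, f q.1 = f q.2 := by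
    induction l generalizing f with
    | nil => simp [tProd, BinRel.one_apply]
    | cons q l ih =>
      obtain ⟨a, b⟩ := q
      rw [tProd_cons, map_mul, BinRel.mul_apply, ht]
      simp only [ih, BinRel.join, List.forall_mem_cons]
      constructor
      · rintro ⟨u, ⟨rfl, h⟩, rfl, h'⟩
        exact ⟨rfl, h, h'⟩
      · rintro ⟨rfl, h, h'⟩
        exact ⟨f, ⟨rfl, h⟩, rfl, h'⟩
  rw [main]
  refine and_congr_right fun _ => ⟨fun h a b hab => ?_, fun h q hq => h _ _ (.rel _ _ hq)⟩
  induction (hab : Relation.EqvGen (fun a b => (a, b) ∈ l) a b) with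
  | rel a b hab => exact h _ hab
  | refl => rfl
  | symm a b hab ih => exact ih.symm
  | trans a b c h₁ h₂ ih₁ ih₂ => exact ih₁.trans ih₂

variable [DecidableEq ι]

theorem HolePath.eval (he : ∀ i, F (e i) = BinRel.cut i) (ht : ∀ i j, F (t i j) = BinRel.join i j)
    {S : Finset ι} {k h : ι} {σ : Equiv.Perm ι} {p : M} (hp : HolePath e t S k h σ p) :
    F p = BinRel.shift k σ := by
  induction hp with
  | nil => exact he k
  | snoc x hx hp ih =>
    rw [map_mul, ih, holeStep, map_mul, map_mul, he, he, ht, ← BinRel.shift_mul_shift hp.perm_apply,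
      ← BinRel.holeStep_eq_shift, holeStep]

theorem eProd_eval (he : ∀ i, F (e i) = BinRel.cut i) (A : Finset ι) (f g : ι → Prop) :
    F (eProd e A) f g ↔ ∀ x ∉ A, f x = g x := by
  rw [eProd]
  simp only [← Finset.mem_toList (s := A)]
  induction A.toList generalizing f with
  | nil => simp [BinRel.one_apply, funext_iff]
  | cons a l ih =>
    rw [List.map_cons, List.prod_cons, map_mul, BinRel.mul_apply, he]
    simp only [ih, List.mem_cons, not_or]
    constructor
    · rintro ⟨u, h₁, h₂⟩ x ⟨hxa, hx⟩
      rw [h₁ x hxa, h₂ x hx]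
    · intro h
      refine ⟨Function.update f a (g a), fun x hx => (Function.update_of_ne hx _ _).symm,
        fun x hx => ?_⟩
      rcases eq_or_ne x a with rfl | hxa
      · rw [Function.update_self]
      · rw [Function.update_of_ne hxa, h x ⟨hxa, hx⟩]

theorem Represents.eval [Fintype ι] (he : ∀ i, F (e i) = BinRel.cut i)
    (ht : ∀ i j, F (t i j) = BinRel.join i j) {l l' : List (ι × ι)} {A : Finset ι}
    {σ : Equiv.Perm ι} {m : M} (h : Represents e t l A σ l' m) (f g : ι → Prop) :
    F m f g ↔ (∀ a b, pairSetoid l a b → f a = f b) ∧ (∀ a b, pairSetoid l' a b → g a = g b) ∧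
      ∀ x ∉ A, f x = g (σ x) := by
  obtain ⟨k, hk, g', p, hp, rfl⟩ := h
  simp only [map_mul, BinRel.mul_apply, tProd_eval ht, eProd_eval he, hp.eval he ht]
  constructor
  · rintro ⟨u, ⟨v, ⟨rfl, hf⟩, w, hA, hw⟩, rfl, hu⟩
    exact ⟨hf, hu, fun x hx => (hA x hx).trans (hw x fun h => hx (h ▸ hk))⟩
  · rintro ⟨hf, hg, hA⟩
    exact ⟨g, ⟨f, ⟨rfl, hf⟩, g ∘ σ, hA, fun _ _ => rfl⟩, rfl, hg⟩

end Evaluation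

section Separation

variable {ι M : Type*} [Monoid M] [DecidableEq ι] [Fintype ι] {e : ι → M} {t : ι → ι → M}
  {F : M →* BinRel (ι → Prop)} {l l' : List (ι × ι)} {A : Finset ι} {σ : Equiv.Perm ι} {m : M}

theorem Represents.rel_indicator_upper (he : ∀ i, F (e i) = BinRel.cut i)
    (ht : ∀ i j, F (t i j) = BinRel.join i j) (h : Represents e t l A σ l' m)
    (hinj : ∀ a ∉ A, ∀ b ∉ A, pairSetoid l' (σ a) (σ b) → a = b) (a : ι) :
    F m (pairSetoid l a) fun y => ∃ x ∉ A, pairSetoid l a x ∧ pairSetoid l' (σ x) y := by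
  refine (h.eval he ht _ _).2 ⟨fun b c hbc => propext ⟨fun hb => ?_, fun hc => ?_⟩,
    fun b c hbc => propext ⟨fun ⟨x, hx, hax, hxb⟩ => ?_, fun ⟨x, hx, hax, hxc⟩ => ?_⟩,
    fun x hx => propext ⟨fun hax => ⟨x, hx, hax, Setoid.refl' _ _⟩, fun ⟨z, hz, haz, hzx⟩ => ?_⟩⟩
  · exact Setoid.trans' _ hb hbc
  · exact Setoid.trans' _ hc (Setoid.symm' _ hbc)
  · exact ⟨x, hx, hax, Setoid.trans' _ hxb hbc⟩
  · exact ⟨x, hx, hax, Setoid.trans' _ hxc (Setoid.symm' _ hbc)⟩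
  · exact hinj z hz x hx hzx ▸ haz

theorem Represents.rel_indicator_lower (he : ∀ i, F (e i) = BinRel.cut i)
    (ht : ∀ i j, F (t i j) = BinRel.join i j) (h : Represents e t l A σ l' m)
    (hinj : ∀ a ∉ A, ∀ b ∉ A, pairSetoid l a b → a = b) (y : ι) :
    F m (fun a => ∃ x ∉ A, pairSetoid l a x ∧ pairSetoid l' (σ x) y) (pairSetoid l' y) := by
  refine (h.eval he ht _ _).2 ⟨fun b c hbc => propext ⟨fun ⟨x, hx, hbx, hxy⟩ => ?_,
    fun ⟨x, hx, hcx, hxy⟩ => ?_⟩, fun b c hbc => propext ⟨fun hb => ?_, fun hc => ?_⟩,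
    fun x hx => propext ⟨fun ⟨z, hz, hxz, hzy⟩ => ?_,
      fun hyx => ⟨x, hx, Setoid.refl' _ _, Setoid.symm' _ hyx⟩⟩⟩
  · exact ⟨x, hx, Setoid.trans' _ (Setoid.symm' _ hbc) hbx, hxy⟩
  · exact ⟨x, hx, Setoid.trans' _ hbc hcx, hxy⟩
  · exact Setoid.trans' _ hb hbc
  · exact Setoid.trans' _ hc (Setoid.symm' _ hbc)
  · exact hinj x hx z hz hxz ▸ Setoid.symm' _ hzy

theorem Represents.upper_iff (he : ∀ i, F (e i) = BinRel.cut i)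
    (ht : ∀ i j, F (t i j) = BinRel.join i j) (h : Represents e t l A σ l' m)
    (hinj : ∀ a ∉ A, ∀ b ∉ A, pairSetoid l' (σ a) (σ b) → a = b) (a b : ι) :
    pairSetoid l a b ↔ ∀ f g, F m f g → f a = f b :=
  ⟨fun hab f g hfg => ((h.eval he ht f g).1 hfg).1 a b hab, fun hab =>
    (hab _ _ (h.rel_indicator_upper he ht hinj a)).mp (Setoid.refl' _ a)⟩

theorem Represents.lower_iff (he : ∀ i, F (e i) = BinRel.cut i)
    (ht : ∀ i j, F (t i j) = BinRel.join i j) (h : Represents e t l A σ l' m)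
    (hinj : ∀ a ∉ A, ∀ b ∉ A, pairSetoid l a b → a = b) (a b : ι) :
    pairSetoid l' a b ↔ ∀ f g, F m f g → g a = g b :=
  ⟨fun hab f g hfg => ((h.eval he ht f g).1 hfg).2.1 a b hab, fun hab =>
    (hab _ _ (h.rel_indicator_lower he ht hinj a)).mp (Setoid.refl' _ a)⟩

theorem Represents.transversal_iff (he : ∀ i, F (e i) = BinRel.cut i)
    (ht : ∀ i j, F (t i j) = BinRel.join i j) (h : Represents e t l A σ l' m)
    (hinj : ∀ a ∉ A, ∀ b ∉ A, pairSetoid l' (σ a) (σ b) → a = b) (a y : ι) :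
    (∃ x ∉ A, pairSetoid l a x ∧ pairSetoid l' (σ x) y) ↔ ∀ f g, F m f g → f a = g y := by
  refine ⟨fun ⟨x, hx, hax, hxy⟩ f g hfg => ?_, fun hay =>
    (hay _ _ (h.rel_indicator_upper he ht hinj a)).mp (Setoid.refl' _ a)⟩
  obtain ⟨hf, hg, hA⟩ := (h.eval he ht f g).1 hfg
  rw [hf a x hax, hA x hx, hg _ _ hxy]

end Separation

/-- Elements that factorize are determined by their action on colourings. -/
theorem Represents.eq_of_map_eq {n : ℕ} {M : Type*} [Monoid M] {e : Fin n → M}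
    {t : Fin n → Fin n → M} {F : M →* BinRel (Fin n → Prop)} (H : SingularRelations e t)
    (he : ∀ i, F (e i) = BinRel.cut i) (ht : ∀ i j, F (t i j) = BinRel.join i j)
    {l l' l₁ l₁' : List (Fin n × Fin n)} {A A₁ : Finset (Fin n)} {σ σ₁ : Equiv.Perm (Fin n)}
    {m m₁ : M} (h : Represents e t l A σ l' m) (h₁ : Represents e t l₁ A₁ σ₁ l₁' m₁)
    (hF : F m = F m₁) : m = m₁ := by
  obtain ⟨l, A, σ, l', h, hc⟩ := h.exists_canonical H
  obtain ⟨l₁, A₁, σ₁, l₁', h₁, hc₁⟩ := h₁.exists_canonical H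
  have upper {l l' : List (Fin n × Fin n)} {A : Finset (Fin n)} {σ : Equiv.Perm (Fin n)}
      (hc : ∀ c ∉ A, (∀ d, pairSetoid l c d → c ≤ d) ∧ ∀ y, pairSetoid l' (σ c) y → σ c ≤ y) :
      ∀ a ∉ A, ∀ b ∉ A, pairSetoid l a b → a = b := fun a ha b hb hab =>
    ((hc a ha).1 b hab).antisymm ((hc b hb).1 a (Setoid.symm' _ hab))
  have lower {l l' : List (Fin n × Fin n)} {A : Finset (Fin n)} {σ : Equiv.Perm (Fin n)}
      (hc : ∀ c ∉ A, (∀ d, pairSetoid l c d → c ≤ d) ∧ ∀ y, pairSetoid l' (σ c) y → σ c ≤ y) :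
      ∀ a ∉ A, ∀ b ∉ A, pairSetoid l' (σ a) (σ b) → a = b := fun a ha b hb hab =>
    σ.injective (((hc a ha).2 _ hab).antisymm ((hc b hb).2 _ (Setoid.symm' _ hab)))
  have hl : pairSetoid l = pairSetoid l₁ := Setoid.ext fun a b => by
    rw [h.upper_iff he ht (lower hc), h₁.upper_iff he ht (lower hc₁), hF]
  have hl' : pairSetoid l' = pairSetoid l₁' := Setoid.ext fun a b => by
    rw [h.lower_iff he ht (upper hc), h₁.lower_iff he ht (upper hc₁), hF]
  have htr (a y : Fin n) : (∃ x ∉ A, pairSetoid l a x ∧ pairSetoid l' (σ x) y) ↔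
      ∃ x ∉ A₁, pairSetoid l₁ a x ∧ pairSetoid l₁' (σ₁ x) y := by
    rw [h.transversal_iff he ht (lower hc), h₁.transversal_iff he ht (lower hc₁), hF]
  have sub {l l' l₁ l₁' : List (Fin n × Fin n)} {A A₁ : Finset (Fin n)}
      {σ σ₁ : Equiv.Perm (Fin n)}
      (hc : ∀ c ∉ A, (∀ d, pairSetoid l c d → c ≤ d) ∧ ∀ y, pairSetoid l' (σ c) y → σ c ≤ y)
      (hc₁ : ∀ c ∉ A₁, (∀ d, pairSetoid l₁ c d → c ≤ d) ∧
        ∀ y, pairSetoid l₁' (σ₁ c) y → σ₁ c ≤ y)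
      (hl : pairSetoid l = pairSetoid l₁) (hl' : pairSetoid l' = pairSetoid l₁')
      (htr : ∀ a y, (∃ x ∉ A, pairSetoid l a x ∧ pairSetoid l' (σ x) y) →
        ∃ x ∉ A₁, pairSetoid l₁ a x ∧ pairSetoid l₁' (σ₁ x) y) (c : Fin n) (hcA : c ∉ A) :
      c ∉ A₁ ∧ σ c = σ₁ c := by
    obtain ⟨x, hx, hcx, hxc⟩ := htr c (σ c) ⟨c, hcA, Setoid.refl' _ _, Setoid.refl' _ _⟩
    obtain rfl : c = x := ((hc c hcA).1 x (hl ▸ hcx)).antisymm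
      ((hc₁ x hx).1 c (Setoid.symm' _ hcx))
    exact ⟨hx, ((hc c hcA).2 _ (hl' ▸ Setoid.symm' _ hxc)).antisymm ((hc₁ c hx).2 _ hxc)⟩
  have hsub := sub hc hc₁ hl hl' fun a y => (htr a y).1
  have hsub₁ := sub hc₁ hc hl.symm hl'.symm fun a y => (htr a y).2
  obtain rfl : A = A₁ := Finset.ext fun c => by
    by_contra hne
    by_cases hcA : c ∈ A
    · exact (hsub₁ c fun h => hne (iff_of_true hcA h)).1 hcA
    · exact (hsub c hcA).1 (by_contra fun h => hne (iff_of_false hcA h))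
  exact Represents.unique H h h₁ hl hl' fun c hc => (hsub c hc).2

/-- The relation on `2`-colourings of the rows induced by a partition of the `2n`-set: two
colourings are related if together they are constant on the blocks. -/
def colouringRel {n : ℕ} (α : PartEq n) : BinRel (Fin n → Prop) :=
  fun f g => ∀ x y, α x y → (Sum.elim f g x = Sum.elim f g y)

theorem colouringRel_injective {n : ℕ} : Function.Injective (colouringRel (n := n)) := by
  have sub {α β : PartEq n} (h : colouringRel α = colouringRel β) (x y) (hxy : β x y) : α x y := by
    have hα : colouringRel α (fun a => α x (.inl a)) fun a => α x (.inr a) := fun u v huv =>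
      propext <| by
        rcases u with u | u <;> rcases v with v | v <;>
          exact ⟨fun hu => α.trans' hu huv, fun hv => α.trans' hv (α.symm' huv)⟩
    rw [h] at hα
    have := hα x y hxy
    rcases x with x | x <;> rcases y with y | y <;> exact this.mp (α.refl' _)
  exact fun α β h => Setoid.ext fun x y => ⟨sub h.symm x y, sub h x y⟩

theorem colouringRel_kernelSetoid {n : ℕ} {γ : Type*} (φ : Fin n ⊕ Fin n → γ) (f g : Fin n → Prop) :
    colouringRel (kernelSetoid φ) f g ↔ ∀ x y, φ x = φ y → Sum.elim f g x = Sum.elim f g y :=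
  Iff.rfl

theorem colouringRel_pcompose {n : ℕ} (α β : PartEq n) :
    colouringRel (pcompose α β) = colouringRel α * colouringRel β := by
  have emb₁₂ (f g h : Fin n → Prop) (a : Fin n ⊕ Fin n) :
      Sum.elim f (Sum.elim h g) (emb12 a) = Sum.elim f h a := by cases a <;> rfl
  have emb₂₃ (f g h : Fin n → Prop) (a : Fin n ⊕ Fin n) :
      Sum.elim f (Sum.elim h g) (emb23 a) = Sum.elim h g a := by cases a <;> rfl
  have emb₁₃ (f g h : Fin n → Prop) (a : Fin n ⊕ Fin n) :
      Sum.elim f (Sum.elim h g) (emb13 a) = Sum.elim f g a := by cases a <;> rfl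
  refine BinRel.ext fun f g => ⟨fun hfg => ?_, ?_⟩
  · let s : Setoid (Fin n ⊕ (Fin n ⊕ Fin n)) := Relation.EqvGen.setoid fun u v =>
      (∃ a b, α.r a b ∧ u = emb12 a ∧ v = emb12 b) ∨ (∃ a b, β.r a b ∧ u = emb23 a ∧ v = emb23 b)
    let c : Fin n ⊕ (Fin n ⊕ Fin n) → Prop := fun u => ∃ x, s (emb13 x) u ∧ Sum.elim f g x
    have hc (x) : c (emb13 x) = Sum.elim f g x :=
      propext ⟨fun ⟨y, hyx, hy⟩ => (hfg y x hyx).mp hy, fun hx => ⟨x, s.refl' _, hx⟩⟩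
    have hs {u v} (huv : s u v) : c u = c v :=
      propext ⟨fun ⟨x, hxu, hx⟩ => ⟨x, s.trans' hxu huv, hx⟩,
        fun ⟨x, hxv, hx⟩ => ⟨x, s.trans' hxv (s.symm' huv), hx⟩⟩
    have hcf : c = Sum.elim f (Sum.elim (fun a => c (.inr (.inl a))) g) := by
      funext u
      rcases u with u | u | u
      · exact hc (.inl u)
      · rfl
      · exact hc (.inr u)
    refine ⟨fun a => c (.inr (.inl a)), fun x y hxy => ?_, fun x y hxy => ?_⟩
    · rw [← emb₁₂ f g, ← emb₁₂ f g, ← hcf]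
      exact hs (.rel _ _ (.inl ⟨x, y, hxy, rfl, rfl⟩))
    · rw [← emb₂₃ f g, ← emb₂₃ f g, ← hcf]
      exact hs (.rel _ _ (.inr ⟨x, y, hxy, rfl, rfl⟩))
  · rintro ⟨h, hα, hβ⟩ x y hxy
    rw [← emb₁₃ f g h, ← emb₁₃ f g h]
    change Relation.EqvGen _ (emb13 x) (emb13 y) at hxy
    generalize emb13 x = u, emb13 y = v at hxy
    induction hxy with
    | rel u v huv =>
      rcases huv with ⟨a, b, hab, rfl, rfl⟩ | ⟨a, b, hab, rfl, rfl⟩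
      · rw [emb₁₂, emb₁₂, hα a b hab]
      · rw [emb₂₃, emb₂₃, hβ a b hab]
    | refl => rfl
    | symm u v huv ih => exact ih.symm
    | trans u v w huv hvw ih₁ ih₂ => exact ih₁.trans ih₂

theorem colouringRel_idPart (n : ℕ) : colouringRel (idPart n) = 1 :=
  BinRel.ext fun f g => by
    rw [idPart, colouringRel_kernelSetoid]
    simp only [Sum.forall, Sum.elim_inl, Sum.elim_inr, BinRel.one_apply, funext_iff]
    grind

theorem colouringRel_ebarP {n : ℕ} (r : Fin n) : colouringRel (ebarP r) = BinRel.cut r :=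
  BinRel.ext fun f g => by
    rw [ebarP, colouringRel_kernelSetoid]
    simp only [Sum.forall, Sum.elim_inl, Sum.elim_inr, BinRel.cut]
    grind

theorem colouringRel_tbarP {n : ℕ} (i j : Fin n) : colouringRel (tbarP i j) = BinRel.join i j :=
  BinRel.ext fun f g => by
    rw [tbarP, colouringRel_kernelSetoid]
    simp only [Sum.forall, Sum.elim_inl, Sum.elim_inr, BinRel.join, funext_iff]
    grind

theorem colouringRel_genX_inr {n : ℕ} (i j : Fin n) :
    colouringRel (genX (.inr s(i, j))) = BinRel.join i j := by
  change colouringRel (tbarP (min i j) (max i j)) = _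
  rw [colouringRel_tbarP]
  rcases le_total i j with h | h
  · rw [min_eq_left h, max_eq_right h]
  · rw [min_eq_right h, max_eq_left h, BinRel.singularRelations.t_symm]

/-- The monoid homomorphism sending a word to the relation on colourings induced by its image
in the partition monoid. -/
def wordRel (n : ℕ) : FreeMonoid (XA n) →* BinRel (Fin n → Prop) :=
  FreeMonoid.lift (colouringRel ∘ genX)

theorem colouringRel_PhiX {n : ℕ} (w : FreeMonoid (XA n)) :
    colouringRel (PhiX w) = wordRel n w := by
  have foldl (L : List (XA n)) (α : PartEq n) : colouringRel ((L.map genX).foldl pcompose α) =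
      colouringRel α * wordRel n (FreeMonoid.ofList L) := by
    induction L generalizing α with
    | nil => exact (mul_one _).symm
    | cons x L ih =>
      rw [List.map_cons, List.foldl_cons, ih, colouringRel_pcompose, FreeMonoid.ofList_cons,
        map_mul, mul_assoc]
      rfl
  rcases h : FreeMonoid.toList w with _ | ⟨x, L⟩
  · rw [PhiX, h, colouringRel_idPart, ← FreeMonoid.ofList_toList w, h]
    rfl
  · rw [PhiX, h]
    refine (foldl L _).trans ?_
    rw [← FreeMonoid.ofList_toList w, h, FreeMonoid.ofList_cons, map_mul]
    rfl

theorem wordRel_E {n : ℕ} (i : Fin n) : wordRel n (E i) = BinRel.cut i :=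
  colouringRel_ebarP i

theorem wordRel_T {n : ℕ} (i j : Fin n) : wordRel n (T i j) = BinRel.join i j :=
  colouringRel_genX_inr i j

/-- The class of `e_i` in the presented monoid. -/
def eClass {n : ℕ} (i : Fin n) : (xcon n).Quotient := (xcon n).mk' (E i)

/-- The class of `t_{ij}` in the presented monoid, or `1` if `i = j`. -/
def tClass {n : ℕ} (i j : Fin n) : (xcon n).Quotient := if i = j then 1 else (xcon n).mk' (T i j)

theorem tClass_of_ne {n : ℕ} {i j : Fin n} (h : i ≠ j) : tClass i j = (xcon n).mk' (T i j) :=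
  if_neg h

theorem singularRelations_class (n : ℕ) : SingularRelations (eClass (n := n)) tClass := by
  have rel {u v : FreeMonoid (XA n)} (h : XRel u v) : (xcon n).mk' u = (xcon n).mk' v :=
    (Con.eq _).2 (.of _ _ h)
  have mk_E (i : Fin n) : (xcon n).mk' (E i) = eClass i := rfl
  have e_idem (i : Fin n) : eClass i * eClass i = eClass i := by
    simpa only [map_mul, mk_E] using rel (.r1 i)
  have e_idem_assoc (i : Fin n) (x) : eClass i * (eClass i * x) = eClass i * x := by
    rw [← mul_assoc, e_idem]
  have t_self (i : Fin n) : tClass i i = 1 := if_pos rfl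
  have t_symm (i j : Fin n) : tClass i j = tClass j i := by
    simp only [tClass, T, Sym2.eq_swap, eq_comm]
  have t_idem (i j : Fin n) : tClass i j * tClass i j = tClass i j := by
    rcases eq_or_ne i j with rfl | h
    · rw [t_self, one_mul]
    · simpa only [tClass_of_ne h, map_mul, mk_E] using rel (.r3 i j h)
  refine ⟨e_idem, fun i j => ?_, t_self, t_symm, t_idem, fun i j k l => ?_, fun i j k => ?_,
    fun i j k hi hj => ?_, fun i j h => ?_, fun i j => ?_, fun i j k hij hjk hik => ?_,
    fun i j k l hij hik hil hjk hjl hkl => ?_⟩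
  · rcases eq_or_ne i j with rfl | h
    · rfl
    · simpa only [map_mul, mk_E] using rel (.r2 i j h)
  · rcases eq_or_ne i j with rfl | hij
    · rw [t_self, one_mul, mul_one]
    rcases eq_or_ne k l with rfl | hkl
    · rw [t_self, one_mul, mul_one]
    simpa only [tClass_of_ne hij, tClass_of_ne hkl, map_mul, mk_E] using rel (.r4 i j k l hij hkl)
  · rcases eq_or_ne i j with rfl | hij
    · rw [t_self, one_mul, t_symm k, t_idem]
    rcases eq_or_ne j k with rfl | hjk
    · rw [t_self, one_mul, mul_one, t_symm]
    rcases eq_or_ne i k with rfl | hik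
    · rw [t_self, mul_one, t_symm j, t_idem]
    simpa only [tClass_of_ne hij, tClass_of_ne hjk, tClass_of_ne hik.symm, map_mul, mk_E] using
      rel (.r5 i j k hij hjk hik)
  · rcases eq_or_ne i j with rfl | hij
    · rw [t_self, one_mul, mul_one]
    simpa only [tClass_of_ne hij, map_mul, mk_E] using rel (.r6 i j k hij hi hj)
  · simpa only [tClass_of_ne h, map_mul, mk_E] using rel (.r7 i j i h (.inl rfl))
  · rcases eq_or_ne i j with rfl | h
    · rw [t_self, mul_one, e_idem]
    simpa only [tClass_of_ne h, map_mul, mk_E] using rel (.r8 i j i h (.inl rfl))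
  · have := rel (.r9 i j k hij hjk hik)
    simp only [map_mul, mk_E, mul_assoc] at this
    simpa only [tClass_of_ne hij, tClass_of_ne hjk, tClass_of_ne hik, tClass_of_ne hij.symm,
      tClass_of_ne hjk.symm, tClass_of_ne hik.symm, mul_assoc, e_idem_assoc] using this
  · have := rel (.r10 i j k l hij hik hil hjk hjl hkl)
    simp only [map_mul, mk_E, mul_assoc] at this
    simpa only [tClass_of_ne hij, tClass_of_ne hik.symm, tClass_of_ne hjl, tClass_of_ne hkl.symm,
      tClass_of_ne hkl, tClass_of_ne hil.symm, tClass_of_ne hjk, mul_assoc, e_idem_assoc]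
      using this

theorem xcon_le_ker_wordRel (n : ℕ) : xcon n ≤ Con.ker (wordRel n) := by
  have H := BinRel.singularRelations (ι := Fin n)
  refine Con.conGen_le.2 fun u v huv => ?_
  rw [Con.ker_rel]
  cases huv <;> simp only [map_mul, wordRel_E, wordRel_T]
  case r1 i => exact H.e_idem i
  case r2 i j _ => exact H.e_comm i j
  case r3 i j _ => exact H.t_idem i j
  case r4 i j k l _ _ => exact H.t_comm i j k l
  case r5 i j k _ _ _ => exact H.t_triangle i j k
  case r6 i j k _ hi hj => exact H.t_e_comm i j k hi hj
  case r7 i j k hij h =>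
    rcases h with rfl | rfl
    · exact H.t_e_t k j hij
    · exact H.t_e_t_right hij
  case r8 i j k _ h =>
    rcases h with rfl | rfl
    · exact H.e_t_e k j
    · exact H.e_t_e_right i k
  case r9 i j k hij hjk hik =>
    simpa only [mul_assoc, H.e_idem_assoc] using H.hole_triangle i j k hij hjk hik
  case r10 i j k l hij hik hil hjk hjl hkl =>
    simpa only [mul_assoc, H.e_idem_assoc] using H.hole_square i j k l hij hik hil hjk hjl hkl

/-- The homomorphism from the presented monoid to relations on colourings. -/
def classRel (n : ℕ) : (xcon n).Quotient →* BinRel (Fin n → Prop) :=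
  (xcon n).lift (wordRel n) (xcon_le_ker_wordRel n)

theorem classRel_mk {n : ℕ} (w : FreeMonoid (XA n)) :
    classRel n ((xcon n).mk' w) = wordRel n w := rfl

theorem classRel_eClass {n : ℕ} (i : Fin n) : classRel n (eClass i) = BinRel.cut i :=
  wordRel_E i

theorem classRel_tClass {n : ℕ} (i j : Fin n) : classRel n (tClass i j) = BinRel.join i j := by
  rcases eq_or_ne i j with rfl | h
  · rw [tClass, if_pos rfl, map_one, BinRel.singularRelations.t_self]
  · rw [tClass_of_ne h, classRel_mk, wordRel_T]

theorem exists_represents_class {n : ℕ} (w : FreeMonoid (XA n)) (hw : w ≠ 1)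
    (hdiag : ∀ p : Sym2 (Fin n), .inr p ∈ FreeMonoid.toList w → ¬ p.IsDiag) :
    ∃ l A σ l', Represents eClass tClass l A σ l' ((xcon n).mk' w) := by
  have H := singularRelations_class n
  have hT {p : Sym2 (Fin n)} (hp : ¬ p.IsDiag) : ∃ i j, i ≠ j ∧
      (xcon n).mk' (FreeMonoid.of (.inr p)) = tClass i j := by
    induction p with | _ i j
    have hij : i ≠ j := fun h => hp (Sym2.mk_isDiag_iff.2 h)
    exact ⟨i, j, hij, (tClass_of_ne hij).symm⟩
  obtain ⟨L, rfl⟩ := FreeMonoid.ofList.surjective w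
  rw [FreeMonoid.toList_ofList] at hdiag
  induction L using List.reverseRecOn with
  | nil => exact absurd rfl hw
  | append_singleton L x ih =>
    rw [FreeMonoid.ofList_append, FreeMonoid.ofList_singleton, map_mul]
    rcases eq_or_ne L [] with rfl | hL
    · rw [FreeMonoid.ofList_nil, map_one, one_mul]
      rcases x with i | p
      · exact ⟨_, _, _, _, Represents.e_self H i⟩
      · obtain ⟨i, j, hij, h⟩ := hT (hdiag p (by simp))
        rw [h]
        exact ⟨_, _, _, _, Represents.t_self H hij⟩
    · obtain ⟨l, A, σ, l', h⟩ := ih hL fun p hp => hdiag p (List.mem_append_left _ hp)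
      rcases x with i | p
      · exact h.mul_e H i
      · obtain ⟨i, j, -, hx⟩ := hT (hdiag p (by simp))
        rw [hx]
        exact ⟨_, _, _, _, h.mul_t i j⟩

theorem Represents.mem {ι M : Type*} [Monoid M] [DecidableEq ι] [Fintype ι] {e : ι → M}
    {t : ι → ι → M} {l l' : List (ι × ι)} {A : Finset ι} {σ : Equiv.Perm ι} {m : M}
    (h : Represents e t l A σ l' m) {N : Submonoid M} (he : ∀ i, e i ∈ N)
    (ht : ∀ i j, t i j ∈ N) : m ∈ N := by
  obtain ⟨k, -, g, p, hp, rfl⟩ := h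
  have hpN : p ∈ N := by
    induction hp with
    | nil => exact he k
    | snoc x _ _ ih => exact mul_mem ih (mul_mem (mul_mem (he _) (ht _ _)) (he _))
  have htN (l : List (ι × ι)) : tProd t l ∈ N :=
    list_prod_mem fun _ h => by obtain ⟨q, -, rfl⟩ := List.mem_map.1 h; exact ht _ _
  have heN : eProd e A ∈ N :=
    list_prod_mem fun _ h => by obtain ⟨q, -, rfl⟩ := List.mem_map.1 h; exact he _
  exact mul_mem (mul_mem (htN l) (mul_mem heN hpN)) (htN l')

theorem Represents.map_ne_one {ι M : Type*} [Monoid M] [DecidableEq ι] [Fintype ι] {e : ι → M}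
    {t : ι → ι → M} {F : M →* BinRel (ι → Prop)} (he : ∀ i, F (e i) = BinRel.cut i)
    (ht : ∀ i j, F (t i j) = BinRel.join i j) {l l' : List (ι × ι)} {A : Finset ι}
    {σ : Equiv.Perm ι} {m : M} (h : Represents e t l A σ l' m) : F m ≠ 1 := by
  intro h1
  obtain ⟨k, hk, -⟩ := id h
  have hF := h.eval he ht
  simp only [h1, BinRel.one_apply] at hF
  have hne : (fun x => x = k) = fun _ => False :=
    (hF _ _).2 ⟨((hF _ _).1 rfl).1, fun _ _ _ => rfl, fun x hx => eq_false fun h => hx (h ▸ hk)⟩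
  exact (congrFun hne k).mp rfl

theorem exists_pairSetoid_eq {ι : Type*} [Fintype ι] (s : Setoid ι) : ∃ l, pairSetoid l = s := by
  classical
  refine ⟨(Finset.univ.filter fun q : ι × ι => s q.1 q.2).toList, ?_⟩
  simp only [pairSetoid, Finset.mem_toList, Finset.mem_filter, Finset.mem_univ, true_and]
  exact Setoid.eqvGen_of_setoid s

/-- A partition of rank less than `n` is given by its restrictions to the two rows and a partial
permutation which is not defined everywhere. -/
theorem exists_colouringRel_iff {n : ℕ} (α : PartEq n) (hα : prank α < n) :
    ∃ l l' : List (Fin n × Fin n), ∃ A : Finset (Fin n), ∃ σ : Equiv.Perm (Fin n), A.Nonempty ∧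
      ∀ f g, colouringRel α f g ↔ (∀ a b, pairSetoid l a b → f a = f b) ∧
        (∀ a b, pairSetoid l' a b → g a = g b) ∧ ∀ x ∉ A, f x = g (σ x) := by
  classical
  obtain ⟨l, hl⟩ := exists_pairSetoid_eq (α.comap Sum.inl)
  obtain ⟨l', hl'⟩ := exists_pairSetoid_eq (α.comap Sum.inr)
  let Q := {q : Quotient α // (∃ a : Fin n, Quotient.mk α (.inl a) = q) ∧
    ∃ b : Fin n, Quotient.mk α (.inr b) = q}
  choose a ha using fun q : Q => q.2.1
  choose b hb using fun q : Q => q.2.2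
  have ha_inj : Function.Injective a := fun q r h => Subtype.ext <| by rw [← ha, ← ha, h]
  have hb_inj : Function.Injective b := fun q r h => Subtype.ext <| by rw [← hb, ← hb, h]
  let φ := (Equiv.ofInjective a ha_inj).symm.trans (Equiv.ofInjective b hb_inj)
  let σ : Equiv.Perm (Fin n) := φ.extendSubtype
  have hσ (q : Q) : σ (a q) = b q := by
    rw [Equiv.extendSubtype_apply_of_mem φ (a q) ⟨q, rfl⟩]
    simp [φ, Equiv.ofInjective_symm_apply]
  refine ⟨l, l', Finset.univ.filter (· ∉ Set.range a), σ, ?_, fun f g => ?_⟩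
  · by_contra hA
    have hsurj : Function.Surjective a := fun x => by
      by_contra hx
      exact hA ⟨x, Finset.mem_filter.2 ⟨Finset.mem_univ x, hx⟩⟩
    refine hα.ne ((Nat.card_eq_of_bijective a ⟨ha_inj, hsurj⟩).trans ?_)
    simp
  · rw [hl, hl']
    constructor
    · refine fun h => ⟨fun x y hxy => h (.inl x) (.inl y) hxy,
        fun x y hxy => h (.inr x) (.inr y) hxy, fun x hx => ?_⟩
      obtain ⟨q, rfl⟩ : x ∈ Set.range a := by simpa using hx
      rw [hσ]
      exact h (.inl _) (.inr _) (Quotient.exact ((ha q).trans (hb q).symm))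
    · rintro ⟨hf, hg, h⟩
      have key (x y : Fin n) (hxy : α (.inl x) (.inr y)) : f x = g y := by
        let q : Q := ⟨Quotient.mk α (.inl x), ⟨x, rfl⟩, ⟨y, (Quotient.sound hxy).symm⟩⟩
        have hxa : α (.inl x) (.inl (a q)) := Quotient.exact (ha q).symm
        rw [hf x (a q) hxa, h (a q) (by simp), hσ]
        have hby : α (.inr (b q)) (.inr y) := Quotient.exact ((hb q).trans (Quotient.sound hxy))
        exact hg _ _ hby
      rintro (x | x) (y | y) hxy
      · exact hf x y hxy
      · exact key x y hxy
      · exact (key y x (α.symm' hxy)).symm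
      · exact hg x y hxy

/-- The words which involve only letters `t_{ij}` with `i ≠ j`. -/
def nondiagWords (n : ℕ) : Submonoid (FreeMonoid (XA n)) where
  carrier := {w | ∀ p : Sym2 (Fin n), .inr p ∈ FreeMonoid.toList w → ¬ p.IsDiag}
  one_mem' _ hp := absurd hp List.not_mem_nil
  mul_mem' hu hv p hp := (List.mem_append.1 hp).elim (hu p) (hv p)

theorem eClass_mem {n : ℕ} (i : Fin n) : eClass i ∈ (nondiagWords n).map (xcon n).mk' :=
  ⟨E i, fun p hp => by simp [E] at hp, rfl⟩

theorem tClass_mem {n : ℕ} (i j : Fin n) : tClass i j ∈ (nondiagWords n).map (xcon n).mk' := by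
  rcases eq_or_ne i j with rfl | h
  · rw [tClass, if_pos rfl]
    exact one_mem _
  · refine ⟨T i j, fun p hp => ?_, (tClass_of_ne h).symm⟩
    obtain rfl : p = s(i, j) := by simpa [T] using hp
    exact fun hd => h (Sym2.mk_isDiag_iff.1 hd)

theorem exists_word_PhiX_eq {n : ℕ} (α : PartEq n) (hα : prank α < n) :
    ∃ w : FreeMonoid (XA n), w ≠ 1 ∧
      (∀ p : Sym2 (Fin n), .inr p ∈ FreeMonoid.toList w → ¬ p.IsDiag) ∧ PhiX w = α := by
  obtain ⟨l, l', A, σ, ⟨k, hk⟩, h⟩ := exists_colouringRel_iff α hα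
  obtain ⟨p, hp⟩ := HolePath.exists_path (singularRelations_class n) k σ
  have hm : Represents eClass tClass l A σ l' _ := ⟨k, hk, _, p, hp, rfl⟩
  obtain ⟨w, hw, hwm⟩ := hm.mem eClass_mem tClass_mem
  rw [← hwm] at hm
  refine ⟨w, ?_, hw, colouringRel_injective (BinRel.ext fun f g => ?_)⟩
  · rintro rfl
    exact hm.map_ne_one classRel_eClass classRel_tClass (by simp only [map_one])
  · rw [h, colouringRel_PhiX, ← classRel_mk, hm.eval classRel_eClass classRel_tClass]

theorem PhiX_eq_iff {n : ℕ} {u v : FreeMonoid (XA n)} (hu : u ≠ 1) (hv : v ≠ 1)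
    (hud : ∀ p : Sym2 (Fin n), .inr p ∈ FreeMonoid.toList u → ¬ p.IsDiag)
    (hvd : ∀ p : Sym2 (Fin n), .inr p ∈ FreeMonoid.toList v → ¬ p.IsDiag) :
    PhiX u = PhiX v ↔ xcon n u v := by
  rw [← colouringRel_injective.eq_iff, colouringRel_PhiX, colouringRel_PhiX]
  refine ⟨fun h => ?_, fun h => xcon_le_ker_wordRel n h⟩
  obtain ⟨_, _, _, _, hu⟩ := exists_represents_class u hu hud
  obtain ⟨_, _, _, _, hv⟩ := exists_represents_class v hv hvd
  exact (Con.eq _).1 <| hu.eq_of_map_eq (singularRelations_class n) classRel_eClass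
    classRel_tClass hv h

/-- Theorem PnSn: (a) every element of `P_n` of rank `< n` is `φ(w)` for
some nonempty word `w` over `X`; and (b) for nonempty words `u, v` over `X`,
`φ(u) = φ(v)` iff `u ~ v`.  That is, `P_n∖S_n` has semigroup presentation
`⟨ e_r, t_{ij} | (R1)–(R10) ⟩` via `φ`.  (The `hdiag` hypotheses say that the words only
involve genuine letters `t_{ij}` with `i ≠ j`.) -/
theorem stmt18 (n : ℕ) (hn : 2 ≤ n) :
    (∀ α : PartEq n, prank α < n → ∃ w : FreeMonoid (XA n), w ≠ 1 ∧
      (∀ p : Sym2 (Fin n), Sum.inr p ∈ FreeMonoid.toList w → ¬ p.IsDiag) ∧ PhiX w = α) ∧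
    (∀ u v : FreeMonoid (XA n), u ≠ 1 → v ≠ 1 →
      (∀ p : Sym2 (Fin n), Sum.inr p ∈ FreeMonoid.toList u → ¬ p.IsDiag) →
      (∀ p : Sym2 (Fin n), Sum.inr p ∈ FreeMonoid.toList v → ¬ p.IsDiag) →
      (PhiX u = PhiX v ↔ xcon n u v)) := by
  exact ⟨exists_word_PhiX_eq, fun _ _ hu hv hud hvd => PhiX_eq_iff hu hv hud hvd⟩
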